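/- There exists a sequence (ε_N)_{N ≥ 1} of positive real numbers converging to 0 such that, for every N ≥ 1, the function H ↦ λ(ε_N, H) is not monotone increasing on [0, ∞). (Lack of strong diamagnetism: counterexamples to monotonicity of the lowest magnetic Neumann eigenvalue in the field strength, in agreement with the Little–Parks oscillations.) -/

import Mathlib

open MeasureTheory Real Set

noncomputable section

/-- The thin tubular neighbourhood `Ω_ε = {x ∈ Ω : dist(x, ∂Ω) < ε}`. -/
def OmegaEps (Ω : Set (ℝ × ℝ)) (ε : ℝ) : Set (ℝ × ℝ) :=
  {x | x ∈ Ω ∧ Metric.infDist x (frontier Ω) < ε}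

/-- `M` is a `C²`, `2L`-periodic, unit-speed parameterization of `∂Ω`,
injective on a period. -/
def BoundaryParam (Ω : Set (ℝ × ℝ)) (L : ℝ) (M : ℝ → ℝ × ℝ) : Prop :=
  ContDiff ℝ 2 M ∧ Function.Periodic M (2 * L) ∧
  (∀ s : ℝ, (deriv M s).1 ^ 2 + (deriv M s).2 ^ 2 = 1) ∧
  Set.InjOn M (Set.Ico 0 (2 * L)) ∧ Set.range M = frontier Ω

/-- The scalar curl `∂₁A₂ − ∂₂A₁` of a planar vector field. -/
def curl2 (A : ℝ × ℝ → ℝ × ℝ) (x : ℝ × ℝ) : ℝ :=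
  fderiv ℝ (fun y => (A y).2) x (1, 0) - fderiv ℝ (fun y => (A y).1) x (0, 1)

/-- `f` is `C¹` on an open neighbourhood of the closure of `S`. -/
def C1Nhd {E : Type*} [NormedAddCommGroup E] [NormedSpace ℝ E]
    (f : ℝ × ℝ → E) (S : Set (ℝ × ℝ)) : Prop :=
  ∃ U : Set (ℝ × ℝ), IsOpen U ∧ closure S ⊆ U ∧ ContDiffOn ℝ 1 f U

/-- The pointwise squared magnetic gradient `|(∇ − i b A)u|²`. -/
def mgNormSq (b : ℝ) (A : ℝ × ℝ → ℝ × ℝ) (u : ℝ × ℝ → ℂ) (x : ℝ × ℝ) : ℝ :=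
  ‖fderiv ℝ u x (1, 0) - Complex.I * (b : ℂ) * ((A x).1 : ℂ) * u x‖ ^ 2 +
  ‖fderiv ℝ u x (0, 1) - Complex.I * (b : ℂ) * ((A x).2 : ℂ) * u x‖ ^ 2

/-- The lowest magnetic Neumann eigenvalue of `−(∇ − i b A)²` on `Ω_ε`,
characterized variationally as the infimum of Rayleigh quotients. -/
def lam (Ω : Set (ℝ × ℝ)) (A : ℝ × ℝ → ℝ × ℝ) (ε b : ℝ) : ℝ :=
  sInf { r : ℝ | ∃ u : ℝ × ℝ → ℂ, C1Nhd u (OmegaEps Ω ε) ∧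
    (0 < ∫ x in OmegaEps Ω ε, ‖u x‖ ^ 2) ∧
    r = (∫ x in OmegaEps Ω ε, mgNormSq b A u x) /
        (∫ x in OmegaEps Ω ε, ‖u x‖ ^ 2) }

/-- The circulation `γ₀ = |Ω| / |∂Ω|` with `|∂Ω| = 2L`. -/
def gamma0 (Ω : Set (ℝ × ℝ)) (L : ℝ) : ℝ := (volume Ω).toReal / (2 * L)

/-- `i₀(c, a, ε) = inf_{n ∈ ℤ} |n + (L/π)(γ₀(a/ε + c) + a/2)|`. -/
def i0 (L γ₀ c a ε : ℝ) : ℝ :=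
  ⨅ n : ℤ, |(n : ℝ) + (L / π) * (γ₀ * (a / ε + c) + a / 2)|

/-- `e₀(c, a, ε) = a²/12 + (π i₀/L)²`. -/
def e0 (L γ₀ c a ε : ℝ) : ℝ :=
  a ^ 2 / 12 + (π * i0 L γ₀ c a ε / L) ^ 2

/-- The Ginzburg–Landau energy of the pair `(ψ, A')`. -/
def GLenergy (Ω : Set (ℝ × ℝ)) (κ H ε : ℝ) (ψ : ℝ × ℝ → ℂ)
    (A' : ℝ × ℝ → ℝ × ℝ) : ℝ :=
  (∫ x in OmegaEps Ω ε,
      (mgNormSq H A' ψ x - κ ^ 2 * ‖ψ x‖ ^ 2 + κ ^ 2 / 2 * ‖ψ x‖ ^ 4)) +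
  H ^ 2 * ∫ x in Ω, (curl2 A' x - 1) ^ 2

/-- Admissible Ginzburg–Landau configurations. -/
def GLadm (Ω : Set (ℝ × ℝ)) (ε : ℝ) (ψ : ℝ × ℝ → ℂ)
    (A' : ℝ × ℝ → ℝ × ℝ) : Prop :=
  C1Nhd ψ (OmegaEps Ω ε) ∧ C1Nhd A' Ω

/-- The Ginzburg–Landau ground-state energy. -/
def Egs (Ω : Set (ℝ × ℝ)) (κ H ε : ℝ) : ℝ :=
  sInf { E : ℝ | ∃ ψ A', GLadm Ω ε ψ A' ∧ E = GLenergy Ω κ H ε ψ A' }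

/-- signed normal vector field along the curve -/
def nrm (σ : ℝ) (M : ℝ → ℝ × ℝ) (s : ℝ) : ℝ × ℝ :=
  (-(σ * (deriv M s).2), σ * (deriv M s).1)

/-- tubular coordinates -/
def Phi (σ : ℝ) (M : ℝ → ℝ × ℝ) (p : ℝ × ℝ) : ℝ × ℝ :=
  (M p.1 + p.2 • nrm σ M p.1)

/-- the `s`-derivative of `Phi` -/
def dPhis (σ : ℝ) (M : ℝ → ℝ × ℝ) (p : ℝ × ℝ) : ℝ × ℝ :=
  ((deriv M p.1).1 - p.2 * (σ * (deriv (deriv M) p.1).2),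
   (deriv M p.1).2 + p.2 * (σ * (deriv (deriv M) p.1).1))

/-- the differential of `Phi` -/
def dPhi (σ : ℝ) (M : ℝ → ℝ × ℝ) (p : ℝ × ℝ) : ℝ × ℝ →L[ℝ] ℝ × ℝ :=
  LinearMap.toContinuousLinearMap (Matrix.toLin (Module.Basis.finTwoProd ℝ) (Module.Basis.finTwoProd ℝ)
    !![(dPhis σ M p).1, (nrm σ M p.1).1; (dPhis σ M p).2, (nrm σ M p.1).2])

theorem dPhi_apply (σ : ℝ) (M : ℝ → ℝ × ℝ) (p q : ℝ × ℝ) :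
    dPhi σ M p q = q.1 • dPhis σ M p + q.2 • nrm σ M p.1 := by
  unfold dPhi
  rw [Matrix.toLin_finTwoProd_toContinuousLinearMap]
  ext <;> simp <;> ring

theorem dPhi_det (σ : ℝ) (M : ℝ → ℝ × ℝ) (p : ℝ × ℝ) :
    (dPhi σ M p).det = (dPhis σ M p).1 * (nrm σ M p.1).2 - (nrm σ M p.1).1 * (dPhis σ M p).2 := by
  unfold dPhi
  simp only [LinearMap.det_toContinuousLinearMap, LinearMap.det_toLin, Matrix.det_fin_two_of]

theorem hda_fst {f : ℝ → ℝ × ℝ} {f' : ℝ × ℝ} {s : ℝ} (h : HasDerivAt f f' s) :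
    HasDerivAt (fun s => (f s).1) f'.1 s :=
  HasFDerivAt.comp_hasDerivAt (f := f) s (hasFDerivAt_fst (𝕜 := ℝ) (p := f s)) h

theorem hda_snd {f : ℝ → ℝ × ℝ} {f' : ℝ × ℝ} {s : ℝ} (h : HasDerivAt f f' s) :
    HasDerivAt (fun s => (f s).2) f'.2 s :=
  HasFDerivAt.comp_hasDerivAt (f := f) s (hasFDerivAt_snd (𝕜 := ℝ) (p := f s)) h

theorem M_deriv_contDiff {M : ℝ → ℝ × ℝ} (hM : ContDiff ℝ 2 M) : ContDiff ℝ 1 (deriv M) := by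
  have : ContDiff ℝ (1 + 1) M := by simpa [one_add_one_eq_two] using hM
  exact (contDiff_succ_iff_deriv.1 this).2.2

theorem M_hasDeriv {M : ℝ → ℝ × ℝ} (hM : ContDiff ℝ 2 M) (s : ℝ) : HasDerivAt M (deriv M s) s :=
  ((hM.differentiable (by norm_num)) s).hasDerivAt

theorem M_hasDeriv2 {M : ℝ → ℝ × ℝ} (hM : ContDiff ℝ 2 M) (s : ℝ) : HasDerivAt (deriv M) (deriv (deriv M) s) s :=
  (((M_deriv_contDiff hM).differentiable (by norm_num)) s).hasDerivAt

theorem nrm_contDiff {σ : ℝ} {M : ℝ → ℝ × ℝ} (hM : ContDiff ℝ 2 M) : ContDiff ℝ 1 (nrm σ M) := by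
  have h := M_deriv_contDiff hM
  unfold nrm
  fun_prop

theorem nrm_hasDeriv {σ : ℝ} {M : ℝ → ℝ × ℝ} (hM : ContDiff ℝ 2 M) (s : ℝ) : HasDerivAt (nrm σ M)
    (-(σ * (deriv (deriv M) s).2), σ * (deriv (deriv M) s).1) s := by
  have h := M_hasDeriv2 hM s
  have h1 : HasDerivAt (fun s => (deriv M s).1) (deriv (deriv M) s).1 s := hda_fst h
  have h2 : HasDerivAt (fun s => (deriv M s).2) (deriv (deriv M) s).2 s := hda_snd h
  exact ((h2.const_mul σ).neg).prodMk (h1.const_mul σ)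

theorem Phi_contDiff {σ : ℝ} {M : ℝ → ℝ × ℝ} (hM : ContDiff ℝ 2 M) : ContDiff ℝ 1 (Phi σ M) := by
  have h := nrm_contDiff (σ := σ) hM
  have h1 : ContDiff ℝ 1 M := hM.of_le (by norm_num)
  unfold Phi
  fun_prop

theorem Phi_hasDeriv_s {σ : ℝ} {M : ℝ → ℝ × ℝ} (hM : ContDiff ℝ 2 M) (s t : ℝ) : HasDerivAt (fun s => Phi σ M (s, t)) (dPhis σ M (s, t)) s := by
  have := (M_hasDeriv hM s).add ((nrm_hasDeriv (σ := σ) hM s).const_smul t)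
  convert! this using 1
  ext <;> simp [dPhis] ; ring

theorem Phi_hasDeriv_t {σ : ℝ} {M : ℝ → ℝ × ℝ} (s t : ℝ) : HasDerivAt (fun t => Phi σ M (s, t)) (nrm σ M s) t := by
  have := ((hasDerivAt_id t).smul_const (nrm σ M s)).const_add (M s)
  simpa [Phi] using this

theorem Phi_hasFDerivAt {σ : ℝ} {M : ℝ → ℝ × ℝ} (hM : ContDiff ℝ 2 M) (p : ℝ × ℝ) : HasFDerivAt (Phi σ M) (dPhi σ M p) p := by
  have hd : DifferentiableAt ℝ (Phi σ M) p := (Phi_contDiff hM).differentiable (by norm_num) p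
  have h := hd.hasFDerivAt
  convert h using 1
  have e1 : fderiv ℝ (Phi σ M) p (1, 0) = dPhis σ M p := by
    have h1 : HasDerivAt (fun s : ℝ => (s, p.2)) ((1 : ℝ), (0 : ℝ)) p.1 :=
      (hasDerivAt_id _).prodMk (hasDerivAt_const _ _)
    have := HasFDerivAt.comp_hasDerivAt (x := p.1) (f := fun s : ℝ => (s, p.2)) (l := Phi σ M)
      (by simpa using h) h1
    exact this.unique (Phi_hasDeriv_s hM p.1 p.2)
  have e2 : fderiv ℝ (Phi σ M) p (0, 1) = nrm σ M p.1 := by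
    have h1 : HasDerivAt (fun t : ℝ => (p.1, t)) ((0 : ℝ), (1 : ℝ)) p.2 :=
      (hasDerivAt_const _ _).prodMk (hasDerivAt_id _)
    have := HasFDerivAt.comp_hasDerivAt (x := p.2) (f := fun t : ℝ => (p.1, t)) (l := Phi σ M)
      (by simpa using h) h1
    exact this.unique (Phi_hasDeriv_t p.1 p.2)
  refine ContinuousLinearMap.ext fun q => ?_
  have hq : q = q.1 • ((1 : ℝ), (0 : ℝ)) + q.2 • ((0 : ℝ), (1 : ℝ)) := by ext <;> simp
  rw [dPhi_apply]
  conv_rhs => rw [hq, map_add, map_smul, map_smul, e1, e2]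

/-- quantitative data for the tube around the curve -/
structure Tube (L K c δ : ℝ) (M : ℝ → ℝ × ℝ) : Prop where
  hL : 0 < L
  hK : 0 < K
  hc : 0 < c
  hδ : 0 < δ
  sm : ContDiff ℝ 2 M
  per : ∀ s, M (s + 2 * L) = M s
  unit : ∀ s : ℝ, (deriv M s).1 ^ 2 + (deriv M s).2 ^ 2 = 1
  k_le : ∀ s, ‖deriv (deriv M) s‖ ≤ K
  low : ∀ s s', |s - s'| ≤ L → c * |s - s'| ≤ ‖M s - M s'‖
  d1 : 8 * K * δ ≤ 1
  d2 : 16 * K * δ ≤ c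

theorem norm_fst_le' (x : ℝ × ℝ) : |x.1| ≤ ‖x‖ := norm_fst_le x
theorem norm_snd_le' (x : ℝ × ℝ) : |x.2| ≤ ‖x‖ := norm_snd_le x

theorem deriv_per {M : ℝ → ℝ × ℝ} {T : ℝ} (h : ∀ s, M (s + T) = M s) (s : ℝ) :
    deriv M (s + T) = deriv M s := by
  rw [← deriv_comp_add_const]
  congr 1
  funext s; exact h s

theorem bdd_of_per {f : ℝ → ℝ × ℝ} {T : ℝ} (hT : 0 < T) (hf : Continuous f)
    (h : ∀ s, f (s + T) = f s) : ∃ K, 0 < K ∧ ∀ s, ‖f s‖ ≤ K := by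
  obtain ⟨K, hK⟩ := (isCompact_Icc (a := (0 : ℝ)) (b := T)).exists_bound_of_continuousOn hf.continuousOn
  refine ⟨max K 1, by positivity, fun s => ?_⟩
  obtain ⟨y, hy, e⟩ := Function.Periodic.exists_mem_Ico₀ (f := f) (c := T) h hT s
  rw [e]
  exact (hK y ⟨hy.1, hy.2.le⟩).trans (le_max_left _ _)

theorem deriv_lip {M : ℝ → ℝ × ℝ} (hM : ContDiff ℝ 2 M) {K : ℝ}
    (hK : ∀ s, ‖deriv (deriv M) s‖ ≤ K) (s s' : ℝ) :
    ‖deriv M s - deriv M s'‖ ≤ K * |s - s'| := by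
  have := Convex.norm_image_sub_le_of_norm_deriv_le (f := deriv M) (s := univ) (x := s') (y := s)
    (C := K) (fun x _ => (M_hasDeriv2 hM x).differentiableAt) (fun x _ => hK x) convex_univ
    (mem_univ _) (mem_univ _)
  simpa using this

theorem taylor2 {M : ℝ → ℝ × ℝ} (hM : ContDiff ℝ 2 M) {K : ℝ}
    (hK : ∀ s, ‖deriv (deriv M) s‖ ≤ K) (s s' : ℝ) :
    ‖M s - M s' - (s - s') • deriv M s'‖ ≤ K * |s - s'| ^ 2 := by
  have hK0 : 0 ≤ K := (norm_nonneg _).trans (hK 0)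
  have hd : ∀ x ∈ uIcc s' s, HasDerivWithinAt (fun r => M r - r • deriv M s')
      (deriv M x - deriv M s') (uIcc s' s) x := fun x _ => by
    have := (M_hasDeriv hM x).sub ((hasDerivAt_id x).smul_const (deriv M s'))
    rw [one_smul] at this
    exact this.hasDerivWithinAt
  have := Convex.norm_image_sub_le_of_norm_hasDerivWithin_le (C := K * |s - s'|) hd
    (fun x hx => (deriv_lip hM hK x s').trans (by
      exact mul_le_mul_of_nonneg_left (abs_sub_left_of_mem_uIcc hx) hK0)) (convex_uIcc _ _)
    left_mem_uIcc right_mem_uIcc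
  have e : M s - M s' - (s - s') • deriv M s' = M s - s • deriv M s' - (M s' - s' • deriv M s') := by
    module
  rw [e]
  refine this.trans (le_of_eq ?_)
  rw [Real.norm_eq_abs]; ring

theorem half_le_norm {x : ℝ × ℝ} (h : x.1 ^ 2 + x.2 ^ 2 = 1) : 1 / 2 ≤ ‖x‖ := by
  by_contra hc
  push Not at hc
  have h1 := norm_fst_le' x
  have h2 := norm_snd_le' x
  have := abs_lt.1 (h1.trans_lt hc)
  have := abs_lt.1 (h2.trans_lt hc)
  nlinarith

theorem exists_tube {Ω : Set (ℝ × ℝ)} {L : ℝ} (hL : 0 < L) {M : ℝ → ℝ × ℝ}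
    (hM : BoundaryParam Ω L M) : ∃ K c δ, Tube L K c δ M := by
  obtain ⟨sm, per, unit, inj, -⟩ := hM
  have per2 : ∀ s, deriv (deriv M) (s + 2 * L) = deriv (deriv M) s :=
    deriv_per (deriv_per per)
  obtain ⟨K, hK, hKb⟩ := bdd_of_per (by positivity : 0 < 2 * L)
    (((M_deriv_contDiff sm).continuous_deriv le_rfl)) per2
  set η := 1 / (4 * K) with hη
  have hηp : 0 < η := by positivity
  have near : ∀ s s', |s - s'| ≤ η → 1 / 4 * |s - s'| ≤ ‖M s - M s'‖ := by
    intro s s' h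
    have h1 := taylor2 sm hKb s s'
    have h2 := half_le_norm (unit s')
    have h3 : ‖(s - s') • deriv M s'‖ - ‖M s - M s'‖ ≤ K * |s - s'| ^ 2 :=
      (norm_sub_norm_le _ _).trans (by rw [norm_sub_rev]; exact h1)
    rw [norm_smul, Real.norm_eq_abs] at h3
    have h4 : K * |s - s'| ≤ 1 / 4 := by
      calc K * |s - s'| ≤ K * η := by gcongr
        _ = 1 / 4 := by rw [hη]; field_simp
    have h0 := abs_nonneg (s - s')
    nlinarith
  have hMc : Continuous M := sm.continuous
  obtain ⟨m, hm, hmb⟩ := IsCompact.exists_forall_le' (α := ℝ)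
    (s := Icc (0 : ℝ) (2 * L) ×ˢ (Icc (-L) (-η) ∪ Icc η L)) (f := fun p => ‖M (p.1 + p.2) - M p.1‖)
    (isCompact_Icc.prod (isCompact_Icc.union isCompact_Icc))
    (by fun_prop) (a := 0) (by
      rintro ⟨s, d⟩ ⟨-, hd⟩
      simp only [norm_pos_iff]
      intro h
      have h : M (s + d) = M s := sub_eq_zero.1 h
      have hd' : d ≠ 0 ∧ |d| ≤ L := by
        rcases hd with hd | hd
        · simp only [mem_Icc] at hd
          exact ⟨by linarith, abs_le.2 ⟨by linarith, by linarith⟩⟩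
        · simp only [mem_Icc] at hd
          exact ⟨by linarith, abs_le.2 ⟨by linarith, by linarith⟩⟩
      have hP : (0 : ℝ) < 2 * L := by linarith
      have hr : ∀ x, M (toIcoMod hP 0 x) = M x := fun x => by
        rw [toIcoMod]; exact (Function.Periodic.sub_zsmul_eq per _)
      have key : toIcoMod hP 0 (s + d) = toIcoMod hP 0 s :=
        inj (by simpa using toIcoMod_mem_Ico hP 0 (s + d)) (by simpa using toIcoMod_mem_Ico hP 0 s)
          (by rw [hr, hr, h])
      rw [toIcoMod_eq_toIcoMod] at key
      obtain ⟨k, hk⟩ := key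
      have hk' : -d = k * (2 * L) := by simpa using hk
      have hk0 : k = 0 := by
        by_contra hk0
        have : (1 : ℝ) ≤ |(k : ℝ)| := by exact_mod_cast Int.one_le_abs hk0
        have h2 : |d| = |(k : ℝ)| * (2 * L) := by
          rw [← abs_neg, hk', abs_mul, abs_of_pos hP]
        nlinarith [hd'.2]
      apply hd'.1
      rw [hk0] at hk'
      simp at hk'
      exact hk')
  set c := min (1 / 4) (m / L) with hcdef
  have hc : 0 < c := by positivity
  refine ⟨K, c, min (1 / (8 * K)) (c / (16 * K)), hL, hK, hc, by positivity, sm, per, unit, hKb,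
    ?_, ?_, ?_⟩
  · intro s s' h
    rcases le_total |s - s'| η with h1 | h1
    · refine le_trans ?_ (near s s' h1)
      gcongr
      exact min_le_left _ _
    · obtain ⟨k, hk⟩ : ∃ k : ℤ, s' - k * (2 * L) ∈ Ico 0 (2 * L) := by
        refine ⟨toIcoDiv (by linarith : (0 : ℝ) < 2 * L) 0 s', ?_⟩
        have := toIcoMod_mem_Ico (by linarith : (0 : ℝ) < 2 * L) 0 s'
        rw [toIcoMod, zero_add, zsmul_eq_mul] at this
        exact this
      have e : ∀ x, M (x - k * (2 * L)) = M x := fun x => by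
        have := Function.Periodic.sub_zsmul_eq (f := M) (x := x) per k
        simpa using this
      have := hmb (s' - k * (2 * L), s - s') ⟨⟨hk.1, hk.2.le⟩, by
        rcases abs_cases (s - s') with h2 | h2
        · right; exact ⟨by linarith, by linarith⟩
        · left; exact ⟨by linarith, by linarith⟩⟩
      simp only at this
      rw [show s' - k * (2 * L) + (s - s') = s - k * (2 * L) by ring, e, e] at this
      refine le_trans ?_ this
      calc c * |s - s'| ≤ m / L * L := by
            gcongr
            exact min_le_right _ _
        _ = m := by field_simp
  · calc 8 * K * min (1 / (8 * K)) (c / (16 * K)) ≤ 8 * K * (1 / (8 * K)) := by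
          gcongr; exact min_le_left _ _
      _ = 1 := by field_simp
  · calc 16 * K * min (1 / (8 * K)) (c / (16 * K)) ≤ 16 * K * (c / (16 * K)) := by
          gcongr; exact min_le_right _ _
      _ = c := by field_simp

theorem tube_alg {σ δ K d e t t' x y p q p' q' : ℝ} (hσ : σ = 1 ∨ σ = -1) (hK : 0 < K)
    (hδ : 0 < δ) (hd1 : 8 * K * δ ≤ 1) (hd : d = |e|) (hd0 : 0 ≤ d) (hKd : K * d ≤ 1 / 8)
    (ht : |t| ≤ δ) (u : p ^ 2 + q ^ 2 = 1) (m1 : |p| ≤ 1 ∧ |q| ≤ 1)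
    (t1 : |x - e * p| ≤ K * d ^ 2) (t2 : |y - e * q| ≤ K * d ^ 2)
    (l1 : |p' - p| ≤ K * d) (l2 : |q' - q| ≤ K * d)
    (e1 : x = t' * -(σ * q) - t * -(σ * q')) (e2 : y = t' * (σ * p) - t * (σ * p')) : d = 0 := by
  have hσ1 : |σ| = 1 := by rcases hσ with rfl | rfl <;> simp
  -- tangential component
  have tang : x * p + y * q = t * (σ * ((q' - q) * p - (p' - p) * q)) := by
    rw [e1, e2]; ring
  have tb : |x * p + y * q| ≤ δ * (2 * (K * d)) := by
    rw [tang, abs_mul, abs_mul, hσ1, one_mul]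
    have : |(q' - q) * p - (p' - p) * q| ≤ 2 * (K * d) := by
      refine (abs_sub _ _).trans ?_
      rw [abs_mul, abs_mul]
      nlinarith [abs_nonneg (q' - q), abs_nonneg (p' - p), abs_nonneg p, abs_nonneg q]
    gcongr
  have tl : |(x - e * p) * p + (y - e * q) * q| ≤ 2 * (K * d ^ 2) := by
    refine (abs_add_le _ _).trans ?_
    rw [abs_mul, abs_mul]
    nlinarith [abs_nonneg (x - e * p), abs_nonneg (y - e * q), abs_nonneg p, abs_nonneg q]
  have e3 : (x - e * p) * p + (y - e * q) * q = (x * p + y * q) - e := by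
    linear_combination (-e) * u
  rw [e3] at tl
  have fin : d ≤ δ * (2 * (K * d)) + 2 * (K * d ^ 2) := by
    have : d ≤ |x * p + y * q| + |(x * p + y * q) - e| := by
      rw [hd]
      have := abs_sub (x * p + y * q) ((x * p + y * q) - e)
      simpa using this
    linarith
  have h1 := hd1
  have h2 : δ * (2 * (K * d)) ≤ 1 / 4 * d := by nlinarith
  have h3 : 2 * (K * d ^ 2) ≤ 1 / 4 * d := by nlinarith
  linarith

namespace Tube
variable {L K c δ : ℝ} {M : ℝ → ℝ × ℝ}

theorem per_int (T : Tube L K c δ M) (s : ℝ) (k : ℤ) : M (s + k * (2 * L)) = M s := by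
  have := Function.Periodic.sub_zsmul_eq (f := M) (x := s) T.per (-k)
  rw [neg_smul, sub_neg_eq_add, zsmul_eq_mul] at this
  exact this

theorem dper_int (T : Tube L K c δ M) (s : ℝ) (k : ℤ) :
    deriv M (s + k * (2 * L)) = deriv M s := by
  have := Function.Periodic.sub_zsmul_eq (f := deriv M) (x := s) (deriv_per T.per) (-k)
  rw [neg_smul, sub_neg_eq_add, zsmul_eq_mul] at this
  exact this

theorem nper_int (T : Tube L K c δ M) (σ s : ℝ) (k : ℤ) :
    nrm σ M (s + k * (2 * L)) = nrm σ M s := by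
  simp [nrm, T.dper_int]

theorem Phi_per (T : Tube L K c δ M) (σ s t : ℝ) (k : ℤ) :
    Phi σ M (s + k * (2 * L), t) = Phi σ M (s, t) := by
  simp [Phi, T.per_int, T.nper_int]

theorem Phi_per1 (T : Tube L K c δ M) (σ s t : ℝ) :
    Phi σ M (s + 2 * L, t) = Phi σ M (s, t) := by
  simpa using T.Phi_per σ s t 1

theorem dPhis_per1 (T : Tube L K c δ M) (σ s t : ℝ) :
    dPhis σ M (s + 2 * L, t) = dPhis σ M (s, t) := by
  simp [dPhis, deriv_per T.per, deriv_per (deriv_per T.per)]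

/-- move the parameter within half a period -/
theorem exists_close (hL : 0 < L) (s s' : ℝ) : ∃ k : ℤ, |s - (s' + k * (2 * L))| ≤ L := by
  refine ⟨round ((s - s') / (2 * L)), ?_⟩
  have h := abs_sub_round ((s - s') / (2 * L))
  have e : s - (s' + round ((s - s') / (2 * L)) * (2 * L))
      = ((s - s') / (2 * L) - round ((s - s') / (2 * L))) * (2 * L) := by field_simp; ring
  rw [e, abs_mul, abs_of_pos (by linarith : 0 < 2 * L)]
  nlinarith

theorem exists_Ico (hL : 0 < L) (s : ℝ) : ∃ k : ℤ, s + k * (2 * L) ∈ Ico 0 (2 * L) := by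
  refine ⟨- toIcoDiv (by linarith : (0 : ℝ) < 2 * L) 0 s, ?_⟩
  have := toIcoMod_mem_Ico (by linarith : (0 : ℝ) < 2 * L) 0 s
  simpa [toIcoMod, sub_eq_add_neg] using this

theorem m_le (T : Tube L K c δ M) (s : ℝ) : |(deriv M s).1| ≤ 1 ∧ |(deriv M s).2| ≤ 1 := by
  have := T.unit s
  constructor <;> apply abs_le_of_sq_le_sq <;> nlinarith [sq_nonneg (deriv M s).1, sq_nonneg (deriv M s).2]

theorem norm_nrm_le (T : Tube L K c δ M) {σ : ℝ} (hσ : σ = 1 ∨ σ = -1) (s : ℝ) :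
    ‖nrm σ M s‖ ≤ 1 := by
  have h := T.m_le s
  rw [Prod.norm_def, max_le_iff]
  rcases hσ with rfl | rfl <;> simp [nrm, h.1, h.2]

theorem inj (T : Tube L K c δ M) {σ : ℝ} (hσ : σ = 1 ∨ σ = -1) {s t s' t' : ℝ}
    (ht : |t| ≤ δ) (ht' : |t'| ≤ δ) (h : Phi σ M (s, t) = Phi σ M (s', t')) :
    t = t' ∧ ∃ k : ℤ, s = s' + k * (2 * L) := by
  obtain ⟨k, hk⟩ := exists_close T.hL s s'
  rw [← T.Phi_per σ s' t' k] at h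
  suffices s = s' + k * (2 * L) ∧ t = t' from ⟨this.2, k, this.1⟩
  generalize s' + k * (2 * L) = r at h hk
  clear k s'
  have hK := T.hK
  have hδ := T.hδ
  have hc := T.hc
  have h' : M s - M r = t' • nrm σ M r - t • nrm σ M s := by
    simp only [Phi] at h
    rw [sub_eq_sub_iff_add_eq_add, h]; abel
  have hn1 := T.norm_nrm_le hσ s
  have hn2 := T.norm_nrm_le hσ r
  have hb : ‖M s - M r‖ ≤ 2 * δ := by
    rw [h']
    refine (norm_sub_le _ _).trans ?_
    rw [norm_smul, norm_smul, Real.norm_eq_abs, Real.norm_eq_abs]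
    nlinarith [norm_nonneg (nrm σ M s), norm_nonneg (nrm σ M r), abs_nonneg t, abs_nonneg t']
  have hl := T.low s r hk
  set d := |s - r| with hd
  have hd0 : 0 ≤ d := abs_nonneg _
  have hdb : c * d ≤ 2 * δ := hl.trans hb
  have hKd : K * d ≤ 1 / 8 := by
    have h1 := T.d2
    have : c * (K * d) ≤ c * (1 / 8) := by nlinarith
    exact le_of_mul_le_mul_left this hc
  have htay := taylor2 T.sm T.k_le s r
  have hlip := deriv_lip T.sm T.k_le s r
  rw [← hd] at htay hlip
  have u := T.unit r
  have m1 := T.m_le r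
  have t1 := (norm_fst_le' _).trans htay
  have t2 := (norm_snd_le' _).trans htay
  have l1 := (norm_fst_le' _).trans hlip
  have l2 := (norm_snd_le' _).trans hlip
  have e1 := congrArg Prod.fst h'
  have e2 := congrArg Prod.snd h'
  simp only [Prod.fst_sub, Prod.snd_sub, Prod.smul_fst, Prod.smul_snd, smul_eq_mul, nrm] at t1 t2 l1 l2 e1 e2
  have hd00 : d = 0 := tube_alg hσ hK hδ T.d1 hd hd0 hKd ht u m1 t1 t2 l1 l2 e1 e2
  have hsr : s = r := by
    rw [hd00] at hd
    exact sub_eq_zero.1 (abs_eq_zero.1 hd.symm)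
  refine ⟨hsr, ?_⟩
  have z : ∀ a b : ℝ, (t' - t) * (σ * a) = 0 → (t' - t) * (σ * b) = 0 → a ^ 2 + b ^ 2 = 1 → t = t' := by
    intro a b ha hb hab
    by_contra hne
    have h1 : t' - t ≠ 0 := fun h => hne (by linarith)
    have h2 : σ ≠ 0 := by rcases hσ with rfl | rfl <;> norm_num
    have := (mul_eq_zero.1 ((mul_eq_zero.1 ha).resolve_left h1)).resolve_left h2
    have := (mul_eq_zero.1 ((mul_eq_zero.1 hb).resolve_left h1)).resolve_left h2
    subst a b
    norm_num at hab
  subst hsr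
  refine z (deriv M s).2 (deriv M s).1 ?_ ?_ (by linarith)
  · linear_combination e1
  · linear_combination -e2

theorem det_bounds (T : Tube L K c δ M) {σ : ℝ} (hσ : σ = 1 ∨ σ = -1) {p : ℝ × ℝ}
    (hp : |p.2| ≤ δ) : 1 / 2 ≤ σ * (dPhi σ M p).det ∧ σ * (dPhi σ M p).det ≤ 2 := by
  rw [dPhi_det]
  have u := T.unit p.1
  have m := T.m_le p.1
  have k1 := (norm_fst_le' _).trans (T.k_le p.1)
  have k2 := (norm_snd_le' _).trans (T.k_le p.1)
  simp only [dPhis, nrm]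
  set a := (deriv M p.1).1
  set b := (deriv M p.1).2
  set x := (deriv (deriv M) p.1).1
  set y := (deriv (deriv M) p.1).2
  have hs2 : σ ^ 2 = 1 := by rcases hσ with rfl | rfl <;> norm_num
  have hσ1 : |σ| = 1 := by rcases hσ with rfl | rfl <;> simp
  have e : σ * ((a - p.2 * (σ * y)) * (σ * a) - -(σ * b) * (b + p.2 * (σ * x)))
     = 1 + p.2 * (σ * (b * x - a * y)) := by
    linear_combination (a ^ 2 + b ^ 2 + p.2 * σ * (b * x - a * y)) * hs2 + u
  rw [e]
  have : |p.2 * (σ * (b * x - a * y))| ≤ 1 / 2 := by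
    rw [abs_mul, abs_mul, hσ1, one_mul]
    have h1 : |b * x - a * y| ≤ 2 * K := by
      refine (abs_sub _ _).trans ?_
      rw [abs_mul, abs_mul]
      nlinarith [abs_nonneg a, abs_nonneg b, abs_nonneg x, abs_nonneg y]
    have := T.d1
    calc |p.2| * |b * x - a * y| ≤ δ * (2 * K) := by gcongr; exact T.hδ.le
      _ ≤ 1 / 2 := by linarith
  have := abs_le.1 this
  constructor <;> linarith

theorem abs_det_bounds (T : Tube L K c δ M) {σ : ℝ} (hσ : σ = 1 ∨ σ = -1) {p : ℝ × ℝ}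
    (hp : |p.2| ≤ δ) : |(dPhi σ M p).det| = σ * (dPhi σ M p).det := by
  have := (T.det_bounds hσ hp).1
  rcases hσ with rfl | rfl
  · rw [abs_of_pos] <;> linarith
  · rw [abs_of_neg] <;> linarith

theorem dPhis_bound (T : Tube L K c δ M) {σ : ℝ} (hσ : σ = 1 ∨ σ = -1) {p : ℝ × ℝ}
    (hp : |p.2| ≤ δ) : (dPhis σ M p).1 ^ 2 + (dPhis σ M p).2 ^ 2 ≤ 8 := by
  have m := T.m_le p.1
  have k1 := (norm_fst_le' _).trans (T.k_le p.1)
  have k2 := (norm_snd_le' _).trans (T.k_le p.1)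
  have hσ1 : |σ| = 1 := by rcases hσ with rfl | rfl <;> simp
  have hh : ∀ z, |z| ≤ K → |p.2 * (σ * z)| ≤ 1 := fun z hz => by
    rw [abs_mul, abs_mul, hσ1, one_mul]
    have := T.d1
    have := T.hδ
    have := T.hK
    calc |p.2| * |z| ≤ δ * K := by gcongr
      _ ≤ 1 := by nlinarith
  have a1 := abs_le.1 (hh _ k1)
  have a2 := abs_le.1 (hh _ k2)
  have b1 := abs_le.1 m.1
  have b2 := abs_le.1 m.2
  simp only [dPhis]
  have : ∀ z : ℝ, -2 ≤ z → z ≤ 2 → z ^ 2 ≤ 4 := fun z h1 h2 => by nlinarith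
  have := this ((deriv M p.1).1 - p.2 * (σ * (deriv (deriv M) p.1).2)) (by linarith) (by linarith)
  have := ‹∀ z : ℝ, -2 ≤ z → z ≤ 2 → z ^ 2 ≤ 4› ((deriv M p.1).2 + p.2 * (σ * (deriv (deriv M) p.1).1)) (by linarith) (by linarith)
  linarith

/-- nearest point projection -/
theorem near (T : Tube L K c δ M) {σ : ℝ} (hσ : σ = 1 ∨ σ = -1) {x : ℝ × ℝ} {ε r : ℝ}
    (h : ‖x - M r‖ < ε) : ∃ s t, |t| < 2 * ε ∧ x = Phi σ M (s, t) := by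
  have hMc : Continuous M := T.sm.continuous
  have hx1 : |x.1 - (M r).1| < ε := (norm_fst_le' (x - M r)).trans_lt h
  have hx2 : |x.2 - (M r).2| < ε := (norm_snd_le' (x - M r)).trans_lt h
  have hε : 0 < ε := (norm_nonneg _).trans_lt h
  set f : ℝ → ℝ := fun s => (x.1 - (M s).1) ^ 2 + (x.2 - (M s).2) ^ 2 with hf
  have hfc : Continuous f := by fun_prop
  obtain ⟨s, -, hs⟩ := (isCompact_Icc (a := (0 : ℝ)) (b := 2 * L)).exists_isMinOn
    (nonempty_Icc.2 (by linarith [T.hL])) hfc.continuousOn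
  have hmin : ∀ r, f s ≤ f r := by
    intro r
    obtain ⟨k, hk⟩ := exists_Ico T.hL r
    have := hs ⟨hk.1, hk.2.le⟩
    simpa [hf, T.per_int] using this
  have hm := M_hasDeriv T.sm s
  have hd : HasDerivAt f (2 * (x.1 - (M s).1) * (- (deriv M s).1) +
      2 * (x.2 - (M s).2) * (- (deriv M s).2)) s := by
    have := (((hda_fst hm).const_sub x.1).pow 2).add (((hda_snd hm).const_sub x.2).pow 2)
    convert! this using 1
    simp
  have hlm : IsLocalMin f s := Filter.Eventually.of_forall hmin
  have hz := hlm.hasDerivAt_eq_zero hd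
  have u := T.unit s
  have hs2 : σ ^ 2 = 1 := by rcases hσ with rfl | rfl <;> norm_num
  set X := x.1 - (M s).1 with hX
  set Y := x.2 - (M s).2 with hY
  set a := (deriv M s).1 with ha
  set b := (deriv M s).2 with hb
  have ho : X * a + Y * b = 0 := by linarith
  refine ⟨s, σ * (Y * a - X * b), ?_, ?_⟩
  · have hr := hmin r
    have : f r < 2 * ε ^ 2 := by
      have h1 := sq_lt_sq' (abs_lt.1 hx1).1 (abs_lt.1 hx1).2
      have h2 := sq_lt_sq' (abs_lt.1 hx2).1 (abs_lt.1 hx2).2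
      simp only [hf]; linarith
    have hfs : f s = X ^ 2 + Y ^ 2 := rfl
    apply abs_lt_of_sq_lt_sq _ (by linarith)
    have : (σ * (Y * a - X * b)) ^ 2 = X ^ 2 + Y ^ 2 := by
      linear_combination (Y * a - X * b) ^ 2 * hs2 + (X ^ 2 + Y ^ 2) * u - (X * a + Y * b) * ho
    nlinarith
  · ext
    · simp only [Phi, nrm, Prod.fst_add, Prod.smul_fst, smul_eq_mul, ← ha, ← hb]
      have : x.1 = X + (M s).1 := by rw [hX]; ring
      rw [this]
      linear_combination (-X) * u + a * ho + (Y * a * b - X * b ^ 2) * hs2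
    · simp only [Phi, nrm, Prod.snd_add, Prod.smul_snd, smul_eq_mul, ← ha, ← hb]
      have : x.2 = Y + (M s).2 := by rw [hY]; ring
      rw [this]
      linear_combination (-Y) * u + b * ho - (Y * a ^ 2 - X * a * b) * hs2

end Tube

theorem Phi_neg (M : ℝ → ℝ × ℝ) (σ s t : ℝ) : Phi (-σ) M (s, t) = Phi σ M (s, -t) := by
  ext <;> simp [Phi, nrm]

theorem Phi_zero (M : ℝ → ℝ × ℝ) (σ s : ℝ) : Phi σ M (s, 0) = M s := by
  simp [Phi]

/-- tube with a side in `Ω` -/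
structure STube (Ω : Set (ℝ × ℝ)) (L K c δ σ : ℝ) (M : ℝ → ℝ × ℝ) : Prop extends Tube L K c δ M where
  hσ : σ = 1 ∨ σ = -1
  op : IsOpen Ω
  bd : Bornology.IsBounded Ω
  fr : range M = frontier Ω
  pos : ∀ s t, 0 < t → t < δ → Phi σ M (s, t) ∈ Ω
  npos : ∀ s t, -δ < t → t ≤ 0 → Phi σ M (s, t) ∉ Ω

theorem side_dich {Ω : Set (ℝ × ℝ)} {L K c δ σ : ℝ} {M : ℝ → ℝ × ℝ} (T : Tube L K c δ M)
    (hσ : σ = 1 ∨ σ = -1) (ho : IsOpen Ω) (fr : range M = frontier Ω) :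
    (∀ s t, 0 < t → t < δ → Phi σ M (s, t) ∈ Ω) ∨
    (∀ s t, 0 < t → t < δ → Phi σ M (s, t) ∉ closure Ω) := by
  have hpc : IsPreconnected (Phi σ M '' (univ ×ˢ Ioo 0 δ)) :=
    (isPreconnected_univ.prod isPreconnected_Ioo).image _ (Phi_contDiff T.sm).continuous.continuousOn
  have hdis : ∀ s t, 0 < t → t < δ → Phi σ M (s, t) ∉ frontier Ω := by
    intro s t h1 h2 h
    rw [← fr] at h
    obtain ⟨r, hr⟩ := h
    rw [← Phi_zero M σ r] at hr
    have := (T.inj hσ (by simp [T.hδ.le]) (by rw [abs_of_pos h1]; exact h2.le) hr).1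
    linarith
  rcases hpc.subset_or_subset (u := Ω) (v := (closure Ω)ᶜ) ho isClosed_closure.isOpen_compl
    (disjoint_compl_right_iff_subset.2 subset_closure) (by
      rintro _ ⟨⟨s, t⟩, ⟨-, h1, h2⟩, rfl⟩
      by_contra hh
      simp only [mem_union, mem_compl_iff, not_or, not_not] at hh
      exact hdis s t h1 h2 (by rw [ho.frontier_eq]; exact ⟨hh.2, hh.1⟩)) with h | h
  · left; intro s t h1 h2
    exact h ⟨(s, t), ⟨mem_univ _, h1, h2⟩, rfl⟩
  · right; intro s t h1 h2
    exact h ⟨(s, t), ⟨mem_univ _, h1, h2⟩, rfl⟩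

theorem exists_stube {Ω : Set (ℝ × ℝ)} {L K c δ : ℝ} {M : ℝ → ℝ × ℝ} (T : Tube L K c δ M)
    (ho : IsOpen Ω) (hb : Bornology.IsBounded Ω) (hne : Ω.Nonempty) (fr : range M = frontier Ω) :
    ∃ σ, STube Ω L K c δ σ M := by
  have hnot : ∀ s, M s ∉ Ω := by
    intro s h
    have : M s ∈ frontier Ω := fr ▸ mem_range_self s
    rw [ho.frontier_eq] at this
    exact this.2 h
  have mk : ∀ σ : ℝ, (σ = 1 ∨ σ = -1) → (∀ s t, 0 < t → t < δ → Phi σ M (s, t) ∈ Ω) →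
      (∀ s t, 0 < t → t < δ → Phi (-σ) M (s, t) ∉ closure Ω) → STube Ω L K c δ σ M := by
    intro σ hσ h1 h2
    refine ⟨T, hσ, ho, hb, fr, h1, ?_⟩
    intro s t ht1 ht2
    rcases eq_or_lt_of_le ht2 with rfl | h
    · rw [Phi_zero]; exact hnot s
    · have := h2 s (-t) (by linarith) (by linarith)
      rw [Phi_neg, neg_neg] at this
      exact fun h => this (subset_closure h)
  rcases side_dich T (σ := 1) (Or.inl rfl) ho fr with h1 | h1 <;>
  rcases side_dich T (σ := -1) (Or.inr rfl) ho fr with h2 | h2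
  · exfalso
    have hop : IsOpen (closure Ω) := by
      rw [Metric.isOpen_iff]
      intro x hx
      by_cases hxΩ : x ∈ Ω
      · obtain ⟨ε, hε, h⟩ := Metric.isOpen_iff.1 ho x hxΩ
        exact ⟨ε, hε, h.trans subset_closure⟩
      · have hf : x ∈ frontier Ω := by rw [ho.frontier_eq]; exact ⟨hx, hxΩ⟩
        rw [← fr] at hf
        obtain ⟨r, rfl⟩ := hf
        refine ⟨δ / 2, by linarith [T.hδ], fun y hy => ?_⟩
        rw [Metric.mem_ball, dist_eq_norm] at hy
        obtain ⟨s, t, ht, rfl⟩ := T.near (σ := 1) (Or.inl rfl) hy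
        have ht' := abs_lt.1 ht
        rcases lt_trichotomy t 0 with h | h | h
        · have := h2 s (-t) (by linarith) (by linarith)
          rw [Phi_neg, neg_neg] at this
          exact subset_closure this
        · rw [h, Phi_zero]
          have : M s ∈ frontier Ω := fr ▸ mem_range_self s
          exact this.1
        · exact subset_closure (h1 s t h (by linarith))
    rcases isClopen_iff.1 ⟨isClosed_closure, hop⟩ with h | h
    · rw [closure_empty_iff] at h
      exact hne.ne_empty h
    · have := Metric.isCompact_of_isClosed_isBounded isClosed_closure hb.closure
      rw [h] at this
      exact noncompact_univ _ this
  · exact ⟨1, mk 1 (Or.inl rfl) h1 h2⟩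
  · exact ⟨-1, mk (-1) (Or.inr rfl) h2 (by rwa [neg_neg])⟩
  · exfalso
    have : M 0 ∈ frontier Ω := fr ▸ mem_range_self 0
    obtain ⟨y, hy, hy2⟩ := Metric.mem_closure_iff.1 this.1 (δ / 2) (by linarith [T.hδ])
    rw [dist_comm, dist_eq_norm] at hy2
    obtain ⟨s, t, ht, rfl⟩ := T.near (σ := 1) (Or.inl rfl) hy2
    have ht' := abs_lt.1 ht
    rcases lt_trichotomy t 0 with h | h | h
    · have := h2 s (-t) (by linarith) (by linarith)
      rw [Phi_neg, neg_neg] at this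
      exact this (subset_closure hy)
    · rw [h, Phi_zero] at hy
      exact hnot s hy
    · exact h1 s t h (by linarith) (subset_closure hy)

/-- the open tube -/
def tubeSet (σ δ : ℝ) (M : ℝ → ℝ × ℝ) : Set (ℝ × ℝ) := Phi σ M '' (univ ×ˢ Ioo (-δ) δ)

theorem Tube.local_inv {L K c δ σ : ℝ} {M : ℝ → ℝ × ℝ} (T : Tube L K c δ M)
    (hσ : σ = 1 ∨ σ = -1) {p : ℝ × ℝ} (hp : |p.2| ≤ δ) :
    ∃ g : ℝ × ℝ → ℝ × ℝ, ContDiffAt ℝ 1 g (Phi σ M p) ∧ g (Phi σ M p) = p ∧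
      ∀ᶠ x in nhds (Phi σ M p), Phi σ M (g x) = x := by
  have hdet : (dPhi σ M p).det ≠ 0 := by
    intro h
    have := (T.det_bounds hσ hp).1
    rw [h] at this
    norm_num at this
  set e : (ℝ × ℝ) ≃L[ℝ] (ℝ × ℝ) := (dPhi σ M p).toContinuousLinearEquivOfDetNeZero hdet with he
  have hc : ContDiffAt ℝ 1 (Phi σ M) p := (Phi_contDiff T.sm).contDiffAt
  have hf : HasFDerivAt (Phi σ M) (e : ℝ × ℝ →L[ℝ] ℝ × ℝ) p := by
    have := Phi_hasFDerivAt (σ := σ) T.sm p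
    convert this using 1
    exact ContinuousLinearMap.coe_toContinuousLinearEquivOfDetNeZero _ hdet
  refine ⟨hc.localInverse hf (by norm_num), hc.to_localInverse hf (by norm_num),
    hc.localInverse_apply_image hf (by norm_num), ?_⟩
  have hs : HasStrictFDerivAt (Phi σ M) (e : ℝ × ℝ →L[ℝ] ℝ × ℝ) p :=
    hc.hasStrictFDerivAt' hf (by norm_num)
  exact hs.eventually_right_inverse

theorem Tube.isOpen_image {L K c δ σ : ℝ} {M : ℝ → ℝ × ℝ} (T : Tube L K c δ M)
    (hσ : σ = 1 ∨ σ = -1) {S : Set (ℝ × ℝ)} (hS : IsOpen S) (hSδ : ∀ p ∈ S, |p.2| ≤ δ) :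
    IsOpen (Phi σ M '' S) := by
  rw [isOpen_iff_mem_nhds]
  rintro _ ⟨p, hp, rfl⟩
  obtain ⟨g, hg, hgp, hgi⟩ := T.local_inv hσ (hSδ p hp)
  have : ∀ᶠ x in nhds (Phi σ M p), g x ∈ S :=
    hg.continuousAt.eventually_mem (by rw [hgp]; exact hS.mem_nhds hp)
  filter_upwards [this, hgi] with x h1 h2
  exact ⟨g x, h1, h2⟩

theorem Tube.isOpen_tubeSet {L K c δ σ : ℝ} {M : ℝ → ℝ × ℝ} (T : Tube L K c δ M)
    (hσ : σ = 1 ∨ σ = -1) : IsOpen (tubeSet σ δ M) :=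
  T.isOpen_image hσ (isOpen_univ.prod isOpen_Ioo) (fun _ hp => (abs_lt.2 hp.2).le)

/-- descent of functions periodic in `s` to the tube -/
theorem Tube.descend {L K c δ σ : ℝ} {M : ℝ → ℝ × ℝ} (T : Tube L K c δ M)
    (hσ : σ = 1 ∨ σ = -1) {E : Type*} [NormedAddCommGroup E] [NormedSpace ℝ E]
    (U : ℝ × ℝ → E) (hU : ContDiff ℝ 1 U) (hper : ∀ s t, U (s + 2 * L, t) = U (s, t)) :
    ∃ u : ℝ × ℝ → E, (∀ s t, |t| < δ → u (Phi σ M (s, t)) = U (s, t)) ∧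
      ∀ x ∈ tubeSet σ δ M, ContDiffAt ℝ 1 u x := by
  classical
  have hperk : ∀ (k : ℤ) s t, U (s + k * (2 * L), t) = U (s, t) := by
    intro k s t
    have := Function.Periodic.sub_zsmul_eq (f := fun s => U (s, t)) (x := s) (c := 2 * L)
      (fun s => hper s t) (-k)
    rw [neg_smul, sub_neg_eq_add, zsmul_eq_mul] at this
    exact this
  let u : ℝ × ℝ → E := fun x => if h : ∃ p : ℝ × ℝ, |p.2| < δ ∧ Phi σ M p = x then U h.choose else 0
  have hu : ∀ s t, |t| < δ → u (Phi σ M (s, t)) = U (s, t) := by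
    intro s t ht
    have hex : ∃ p : ℝ × ℝ, |p.2| < δ ∧ Phi σ M p = Phi σ M (s, t) := ⟨(s, t), ht, rfl⟩
    have e : u (Phi σ M (s, t)) = U hex.choose := by
      simp only [u]
      rw [dif_pos hex]
    rw [e]
    obtain ⟨h1, h2⟩ := hex.choose_spec
    generalize hex.choose = q at h1 h2
    obtain ⟨a, b⟩ := q
    obtain ⟨rfl, k, rfl⟩ := T.inj hσ h1.le ht.le h2
    exact hperk k s b
  refine ⟨u, hu, ?_⟩
  rintro _ ⟨p, ⟨-, hp⟩, rfl⟩
  have hp' : |p.2| < δ := abs_lt.2 hp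
  obtain ⟨g, hg, hgp, hgi⟩ := T.local_inv hσ hp'.le
  have hUg : ContDiffAt ℝ 1 (fun x => U (g x)) (Phi σ M p) :=
    hU.contDiffAt.comp _ hg
  refine hUg.congr_of_eventuallyEq ?_
  have : ∀ᶠ x in nhds (Phi σ M p), g x ∈ univ ×ˢ Ioo (-δ) δ :=
    hg.continuousAt.eventually_mem (by
      rw [hgp]; exact (isOpen_univ.prod isOpen_Ioo).mem_nhds ⟨mem_univ _, hp⟩)
  filter_upwards [this, hgi] with x h1 h2
  conv_lhs => rw [← h2]
  exact hu (g x).1 (g x).2 (abs_lt.2 h1.2)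

namespace STube
variable {Ω : Set (ℝ × ℝ)} {L K c δ σ : ℝ} {M : ℝ → ℝ × ℝ}

theorem mem_eps_iff (T : STube Ω L K c δ σ M) {ε : ℝ} {x : ℝ × ℝ} :
    x ∈ OmegaEps Ω ε ↔ x ∈ Ω ∧ ∃ r, ‖x - M r‖ < ε := by
  unfold OmegaEps
  simp only [mem_ofPred_eq]
  rw [Metric.infDist_lt_iff (by rw [← T.fr]; exact range_nonempty _), ← T.fr]
  simp [dist_eq_norm]

theorem isOpen_eps (T : STube Ω L K c δ σ M) (ε : ℝ) : IsOpen (OmegaEps Ω ε) :=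
  T.op.inter (isOpen_lt (Metric.continuous_infDist_pt _) continuous_const)

theorem eps_sub (Ω : Set (ℝ × ℝ)) (ε : ℝ) : OmegaEps Ω ε ⊆ Ω := fun _ h => h.1

theorem coords (T : STube Ω L K c δ σ M) {ε : ℝ} (hε : 2 * ε ≤ δ) {x : ℝ × ℝ}
    (hx : x ∈ OmegaEps Ω ε) : ∃ s t, s ∈ Ico 0 (2 * L) ∧ 0 < t ∧ t < 2 * ε ∧ Phi σ M (s, t) = x := by
  obtain ⟨hxΩ, r, hr⟩ := T.mem_eps_iff.1 hx
  obtain ⟨s, t, ht, rfl⟩ := T.near T.hσ hr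
  obtain ⟨k, hk⟩ := Tube.exists_Ico T.hL s
  have ht' := abs_lt.1 ht
  refine ⟨_, t, hk, ?_, ht'.2, T.Phi_per σ s t k⟩
  by_contra hh
  exact T.npos s t (by linarith) (by linarith) hxΩ

theorem mem_eps (T : STube Ω L K c δ σ M) {ε s t : ℝ} (hε : ε ≤ δ) (h0 : 0 < t) (h1 : t < ε) :
    Phi σ M (s, t) ∈ OmegaEps Ω ε := by
  refine T.mem_eps_iff.2 ⟨T.pos s t h0 (by linarith), s, ?_⟩
  have e : Phi σ M (s, t) - M s = t • nrm σ M s := by simp [Phi]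
  rw [e, norm_smul, Real.norm_eq_abs, abs_of_pos h0]
  nlinarith [T.norm_nrm_le T.hσ s]

theorem star (T : STube Ω L K c δ σ M) {ε s t θ : ℝ} (hε : 2 * ε ≤ δ) (hε2 : 9 * K * ε ≤ c ^ 2)
    (h0 : 0 < t) (h1 : t < 2 * ε) (hx : Phi σ M (s, t) ∈ OmegaEps Ω ε) (hθ : 0 < θ) (hθ1 : θ ≤ 1) :
    Phi σ M (s, θ * t) ∈ OmegaEps Ω ε := by
  obtain ⟨-, r, hr⟩ := T.mem_eps_iff.1 hx
  have hθt : θ * t ≤ t := by nlinarith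
  refine T.mem_eps_iff.2 ⟨T.pos s _ (by positivity) (by linarith), ?_⟩
  obtain ⟨k, hk⟩ := Tube.exists_close T.hL s r
  rw [← T.per_int r k] at hr
  generalize r + k * (2 * L) = r at hk hr
  have hc := T.hc
  have hK := T.hK
  have hεp : 0 < ε := by linarith
  have hsr : c * |s - r| ≤ 3 * ε := by
    refine (T.low s r hk).trans ?_
    have e : M s - M r = (Phi σ M (s, t) - M r) - t • nrm σ M s := by simp [Phi]; abel
    rw [e]
    refine (norm_sub_le _ _).trans ?_
    rw [norm_smul, Real.norm_eq_abs, abs_of_pos h0]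
    nlinarith [T.norm_nrm_le T.hσ s]
  set d := |s - r| with hd
  have hd0 : 0 ≤ d := abs_nonneg _
  have hKd : K * d ^ 2 ≤ ε := by
    have h2 : c ^ 2 * d ^ 2 ≤ 9 * ε ^ 2 := by
      have : (c * d) ^ 2 ≤ (3 * ε) ^ 2 := by gcongr
      nlinarith
    have h3 : c ^ 2 * (K * d ^ 2) ≤ c ^ 2 * ε := by
      calc c ^ 2 * (K * d ^ 2) = K * (c ^ 2 * d ^ 2) := by ring
        _ ≤ K * (9 * ε ^ 2) := by gcongr
        _ = (9 * K * ε) * ε := by ring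
        _ ≤ c ^ 2 * ε := by gcongr
    exact le_of_mul_le_mul_left h3 (by positivity)
  set q := (1 - θ) * s + θ * r with hq
  refine ⟨q, ?_⟩
  have t1 := taylor2 T.sm T.k_le s q
  have t2 := taylor2 T.sm T.k_le r q
  have e1 : |s - q| ^ 2 = θ ^ 2 * d ^ 2 := by
    rw [sq_abs, hd, sq_abs, hq]; ring
  have e2 : |r - q| ^ 2 = (1 - θ) ^ 2 * d ^ 2 := by
    rw [sq_abs, hd, sq_abs, hq]; ring
  rw [e1] at t1
  rw [e2] at t2
  have e : Phi σ M (s, θ * t) - M q = θ • (Phi σ M (s, t) - M r)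
      + ((1 - θ) • (M s - M q - (s - q) • deriv M q) + θ • (M r - M q - (r - q) • deriv M q)) := by
    have h1 : (1 - θ) * (s - q) + θ * (r - q) = 0 := by rw [hq]; ring
    have h2 : ((1 - θ) * (s - q) + θ * (r - q)) • deriv M q = 0 := by rw [h1, zero_smul]
    rw [add_smul] at h2
    simp only [Phi]
    have : ((1 - θ) * (s - q)) • deriv M q = - ((θ * (r - q)) • deriv M q) := by
      rw [eq_neg_iff_add_eq_zero]; exact h2
    rw [smul_sub (1 - θ) _ ((s - q) • deriv M q), smul_smul (1 - θ) (s - q), this]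
    module
  rw [e]
  have n1 : ‖θ • (Phi σ M (s, t) - M r)‖ < θ * ε := by
    rw [norm_smul, Real.norm_eq_abs, abs_of_pos hθ]; gcongr
  have n2 : ‖(1 - θ) • (M s - M q - (s - q) • deriv M q)‖ ≤ (1 - θ) * (K * (θ ^ 2 * d ^ 2)) := by
    rw [norm_smul, Real.norm_eq_abs, abs_of_nonneg (by linarith)]
    exact mul_le_mul_of_nonneg_left t1 (by linarith)
  have n3 : ‖θ • (M r - M q - (r - q) • deriv M q)‖ ≤ θ * (K * ((1 - θ) ^ 2 * d ^ 2)) := by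
    rw [norm_smul, Real.norm_eq_abs, abs_of_pos hθ]
    exact mul_le_mul_of_nonneg_left t2 (by linarith)
  have n4 := norm_add_le (θ • (Phi σ M (s, t) - M r))
    ((1 - θ) • (M s - M q - (s - q) • deriv M q) + θ • (M r - M q - (r - q) • deriv M q))
  have n5 := norm_add_le ((1 - θ) • (M s - M q - (s - q) • deriv M q))
    (θ • (M r - M q - (r - q) • deriv M q))
  have n6 : (1 - θ) * (K * (θ ^ 2 * d ^ 2)) + θ * (K * ((1 - θ) ^ 2 * d ^ 2))
      = (θ * (1 - θ)) * (K * d ^ 2) := by ring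
  have n7 : (θ * (1 - θ)) * (K * d ^ 2) ≤ (1 - θ) * ε := by
    have : θ * (1 - θ) ≤ 1 - θ := by nlinarith
    have h8 : 0 ≤ 1 - θ := by linarith
    calc (θ * (1 - θ)) * (K * d ^ 2) ≤ (1 - θ) * (K * d ^ 2) := by gcongr
      _ ≤ (1 - θ) * ε := by gcongr
  linarith

end STube

open scoped Manifold ContDiff in
theorem exists_ext {E : Type*} [NormedAddCommGroup E] [NormedSpace ℝ E]
    {f : ℝ × ℝ → E} {S : Set (ℝ × ℝ)} (h : C1Nhd f S) :
    ∃ g : ℝ × ℝ → E, ContDiff ℝ 1 g ∧ ∀ x ∈ closure S, g =ᶠ[nhds x] f := by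
  obtain ⟨U, hU, hSU, hf⟩ := h
  obtain ⟨η, h0, h1, -⟩ := exists_contMDiffMap_zero_one_nhds_of_isClosed (n := (⊤ : ℕ∞)) 𝓘(ℝ, ℝ × ℝ)
    hU.isClosed_compl (isClosed_closure (s := S)) (disjoint_compl_left_iff_subset.2 hSU)
  have hη : ContDiff ℝ 1 η := (η.contMDiff.contDiff).of_le (by exact_mod_cast le_top)
  refine ⟨fun x => η x • f x, ?_, ?_⟩
  · rw [contDiff_iff_contDiffAt]
    intro x
    by_cases hx : x ∈ U
    · exact hη.contDiffAt.smul (hf.contDiffAt (hU.mem_nhds hx))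
    · have : ∀ᶠ y in nhds x, η y = 0 := by
        exact (Filter.Eventually.filter_mono (nhds_le_nhdsSet (s := Uᶜ) hx) h0)
      refine (contDiffAt_const (c := (0 : E))).congr_of_eventuallyEq ?_
      filter_upwards [this] with y hy
      simp [hy]
  · intro x hx
    have : ∀ᶠ y in nhds x, η y = 1 := Filter.Eventually.filter_mono (nhds_le_nhdsSet hx) h1
    filter_upwards [this] with y hy
    simp [hy]

/-- Euclidean dot product -/
def dot2 (v w : ℝ × ℝ) : ℝ := v.1 * w.1 + v.2 * w.2

/-- circulation of `A` along the `t`-level curve -/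
def circ (A : ℝ × ℝ → ℝ × ℝ) (σ : ℝ) (M : ℝ → ℝ × ℝ) (L t : ℝ) : ℝ :=
  ∫ s in (0 : ℝ)..2 * L, dot2 (A (Phi σ M (s, t))) (dPhis σ M (s, t))

theorem dPhis_continuous {σ : ℝ} {M : ℝ → ℝ × ℝ} (hM : ContDiff ℝ 2 M) :
    Continuous (dPhis σ M) := by
  have h1 : Continuous (deriv M) := (M_deriv_contDiff hM).continuous
  have h2 : Continuous (deriv (deriv M)) := (M_deriv_contDiff hM).continuous_deriv le_rfl
  unfold dPhis
  fun_prop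

theorem integrand_continuous {σ : ℝ} {M : ℝ → ℝ × ℝ} (hM : ContDiff ℝ 2 M)
    {A : ℝ × ℝ → ℝ × ℝ} (hA : Continuous A) :
    Continuous (fun p => dot2 (A (Phi σ M p)) (dPhis σ M p)) := by
  have h1 := dPhis_continuous (σ := σ) hM
  have h2 := (Phi_contDiff (σ := σ) hM).continuous
  have hc := hA.comp h2
  exact (hc.fst.mul h1.fst).add (hc.snd.mul h1.snd)

theorem circ_continuous {σ L : ℝ} {M : ℝ → ℝ × ℝ} (hM : ContDiff ℝ 2 M)
    {A : ℝ × ℝ → ℝ × ℝ} (hA : Continuous A) : Continuous (circ A σ M L) := by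
  unfold circ
  refine intervalIntegral.continuous_parametric_intervalIntegral_of_continuous' ?_ 0 (2 * L)
  have := integrand_continuous (σ := σ) hM hA
  exact this.comp (continuous_snd.prodMk continuous_fst)

/-- covariant derivative in direction `w` -/
theorem cov_eq (b : ℝ) (A : ℝ × ℝ → ℝ × ℝ) (u : ℝ × ℝ → ℂ) (x w : ℝ × ℝ) :
    fderiv ℝ u x w - Complex.I * (b : ℂ) * (dot2 (A x) w : ℝ) * u x =
      (w.1 : ℂ) * (fderiv ℝ u x (1, 0) - Complex.I * (b : ℂ) * ((A x).1 : ℂ) * u x) +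
      (w.2 : ℂ) * (fderiv ℝ u x (0, 1) - Complex.I * (b : ℂ) * ((A x).2 : ℂ) * u x) := by
  have hq : w = w.1 • ((1 : ℝ), (0 : ℝ)) + w.2 • ((0 : ℝ), (1 : ℝ)) := by ext <;> simp
  have : fderiv ℝ u x w = (w.1 : ℂ) * fderiv ℝ u x (1, 0) + (w.2 : ℂ) * fderiv ℝ u x (0, 1) := by
    conv_lhs => rw [hq, map_add, map_smul, map_smul]
    simp [Complex.real_smul]
  rw [this]
  simp only [dot2]
  push_cast
  ring

theorem cov_le (b : ℝ) (A : ℝ × ℝ → ℝ × ℝ) (u : ℝ × ℝ → ℂ) (x w : ℝ × ℝ) :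
    ‖fderiv ℝ u x w - Complex.I * (b : ℂ) * (dot2 (A x) w : ℝ) * u x‖ ^ 2 ≤
      (w.1 ^ 2 + w.2 ^ 2) * mgNormSq b A u x := by
  rw [cov_eq, mgNormSq]
  set z1 := fderiv ℝ u x (1, 0) - Complex.I * (b : ℂ) * ((A x).1 : ℂ) * u x
  set z2 := fderiv ℝ u x (0, 1) - Complex.I * (b : ℂ) * ((A x).2 : ℂ) * u x
  have h : ‖(w.1 : ℂ) * z1 + (w.2 : ℂ) * z2‖ ≤ |w.1| * ‖z1‖ + |w.2| * ‖z2‖ := by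
    refine (norm_add_le _ _).trans ?_
    simp
  calc ‖(w.1 : ℂ) * z1 + (w.2 : ℂ) * z2‖ ^ 2 ≤ (|w.1| * ‖z1‖ + |w.2| * ‖z2‖) ^ 2 := by gcongr
    _ ≤ (|w.1| ^ 2 + |w.2| ^ 2) * (‖z1‖ ^ 2 + ‖z2‖ ^ 2) := by
      nlinarith [sq_nonneg (|w.1| * ‖z2‖ - |w.2| * ‖z1‖)]
    _ = _ := by rw [sq_abs, sq_abs]

theorem mg_nonneg (b : ℝ) (A : ℝ × ℝ → ℝ × ℝ) (u : ℝ × ℝ → ℂ) (x : ℝ × ℝ) :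
    0 ≤ mgNormSq b A u x := by unfold mgNormSq; positivity

theorem lam_le {Ω : Set (ℝ × ℝ)} {A : ℝ × ℝ → ℝ × ℝ} {ε b η : ℝ} {u : ℝ × ℝ → ℂ}
    (hu : C1Nhd u (OmegaEps Ω ε)) (hpos : 0 < ∫ x in OmegaEps Ω ε, ‖u x‖ ^ 2)
    (h : (∫ x in OmegaEps Ω ε, mgNormSq b A u x) ≤ η * ∫ x in OmegaEps Ω ε, ‖u x‖ ^ 2) :
    lam Ω A ε b ≤ η := by
  have hb : BddBelow { r : ℝ | ∃ u : ℝ × ℝ → ℂ, C1Nhd u (OmegaEps Ω ε) ∧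
    (0 < ∫ x in OmegaEps Ω ε, ‖u x‖ ^ 2) ∧
    r = (∫ x in OmegaEps Ω ε, mgNormSq b A u x) /
        (∫ x in OmegaEps Ω ε, ‖u x‖ ^ 2) } := by
    refine ⟨0, ?_⟩
    rintro _ ⟨v, -, h1, rfl⟩
    exact div_nonneg (integral_nonneg fun x => mg_nonneg _ _ _ _) h1.le
  exact (csInf_le hb ⟨u, hu, hpos, rfl⟩).trans ((div_le_iff₀ hpos).2 h)

namespace STube
variable {Ω : Set (ℝ × ℝ)} {L K c δ σ : ℝ} {M : ℝ → ℝ × ℝ}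

theorem finite_eps (T : STube Ω L K c δ σ M) (ε : ℝ) : volume (OmegaEps Ω ε) < ⊤ :=
  (T.bd.subset (eps_sub Ω ε)).measure_lt_top

theorem vol_pos (T : STube Ω L K c δ σ M) {ε : ℝ} (h0 : 0 < ε) (h : ε ≤ δ) :
    0 < volume.real (OmegaEps Ω ε) := by
  have h1 : (OmegaEps Ω ε).Nonempty :=
    ⟨_, T.mem_eps (s := 0) (t := ε / 2) h (by linarith) (by linarith)⟩
  exact ENNReal.toReal_pos ((T.isOpen_eps ε).measure_pos volume h1).ne' (T.finite_eps ε).ne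

theorem closure_eps (T : STube Ω L K c δ σ M) {ε : ℝ} (h : 0 < ε) :
    closure (OmegaEps Ω ε) ⊆ Metric.thickening (2 * ε) (frontier Ω) := by
  have h1 : closure (OmegaEps Ω ε) ⊆ {x | Metric.infDist x (frontier Ω) ≤ ε} :=
    closure_minimal (fun x hx => hx.2.le)
      (isClosed_le (Metric.continuous_infDist_pt _) continuous_const)
  intro x hx
  rw [Metric.mem_thickening_iff_infDist_lt (by rw [← T.fr]; exact range_nonempty _)]
  exact lt_of_le_of_lt (h1 hx) (by linarith)

theorem compact_fr (T : STube Ω L K c δ σ M) : IsCompact (frontier Ω) :=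
  Metric.isCompact_of_isClosed_isBounded isClosed_frontier (T.bd.closure.subset frontier_subset_closure)

theorem upper (T : STube Ω L K c δ σ M) {A : ℝ × ℝ → ℝ × ℝ} (hA : ContDiff ℝ 1 A) {b : ℝ}
    (hb : ∃ k : ℤ, b * circ A σ M L 0 = 2 * π * k) {η : ℝ} (hη : 0 < η) :
    ∃ ε₀ > 0, ∀ ε, 0 < ε → ε < ε₀ → lam Ω A ε b ≤ η := by
  have hA1 : ContDiff ℝ 1 (fun x => (A x).1) := hA.fst
  have hA2 : ContDiff ℝ 1 (fun x => (A x).2) := hA.snd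
  have hMc : ContDiff ℝ 1 M := T.sm.of_le (by norm_num)
  set g : ℝ → ℝ := fun r => dot2 (A (Phi σ M (r, 0))) (dPhis σ M (r, 0)) with hg
  have hgc : Continuous g :=
    (integrand_continuous T.sm hA.continuous).comp (continuous_id.prodMk continuous_const)
  set G : ℝ → ℝ := fun s => ∫ r in (0 : ℝ)..s, g r with hG
  have hGd : ∀ s, HasDerivAt G (g s) s := fun s =>
    intervalIntegral.integral_hasDerivAt_right (hgc.intervalIntegrable _ _)
      (hgc.stronglyMeasurableAtFilter _ _) hgc.continuousAt
  have hGc : ContDiff ℝ 1 G := by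
    rw [contDiff_one_iff_deriv]
    refine ⟨fun s => (hGd s).differentiableAt, ?_⟩
    rw [show deriv G = g from funext fun s => (hGd s).deriv]
    exact hgc
  have hgper : Function.Periodic g (2 * L) := fun s => by
    simp only [hg, T.Phi_per1, T.dPhis_per1]
  have hGper : ∀ s, G (s + 2 * L) = G s + circ A σ M L 0 := by
    intro s
    have h1 := hgper.intervalIntegral_add_eq s 0
    rw [zero_add] at h1
    have h2 : G (s + 2 * L) = G s + ∫ r in s..(s + 2 * L), g r :=
      (intervalIntegral.integral_add_adjacent_intervals (hgc.intervalIntegrable _ _)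
        (hgc.intervalIntegrable _ _)).symm
    rw [h2, h1]; rfl
  set α : ℝ → ℝ := fun s => dot2 (A (M s)) (nrm σ M s) with hα
  have hαc : ContDiff ℝ 1 α := by
    have := nrm_contDiff (σ := σ) T.sm
    have h1 := hA1.comp hMc
    have h2 := hA2.comp hMc
    exact (h1.mul this.fst).add (h2.mul this.snd)
  have hαper : ∀ s, α (s + 2 * L) = α s := fun s => by
    have := T.nper_int σ s 1
    simp only [Int.cast_one, one_mul] at this
    simp only [hα, T.per, this]
  set U : ℝ × ℝ → ℂ := fun p => Complex.exp (((b * (G p.1 + p.2 * α p.1) : ℝ) : ℂ) * Complex.I) with hU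
  have hUr : ContDiff ℝ 1 (fun p : ℝ × ℝ => b * (G p.1 + p.2 * α p.1)) := by fun_prop
  have hUc : ContDiff ℝ 1 U := by
    have h2 : ContDiff ℝ 1 (fun p : ℝ × ℝ => ((b * (G p.1 + p.2 * α p.1) : ℝ) : ℂ)) :=
      Complex.ofRealCLM.contDiff.comp hUr
    exact (h2.mul contDiff_const).cexp
  have hUper : ∀ s t, U (s + 2 * L, t) = U (s, t) := by
    intro s t
    obtain ⟨k, hk⟩ := hb
    simp only [hU, hGper, hαper]
    rw [Complex.exp_eq_exp_iff_exists_int]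
    refine ⟨k, ?_⟩
    have : b * (G s + circ A σ M L 0 + t * α s) = b * (G s + t * α s) + 2 * π * k := by
      rw [← hk]; ring
    rw [this]
    push_cast
    ring
  obtain ⟨u, hu, huc⟩ := T.descend T.hσ U hUc hUper
  have hTo := T.isOpen_tubeSet T.hσ
  have hMmem : ∀ s, M s ∈ tubeSet σ δ M := fun s =>
    ⟨(s, 0), ⟨mem_univ _, by simp [T.hδ]⟩, Phi_zero M σ s⟩
  have hucO : ContDiffOn ℝ 1 u (tubeSet σ δ M) := fun x hx => (huc x hx).contDiffWithinAt
  have hcont : ContinuousOn (mgNormSq b A u) (tubeSet σ δ M) := by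
    have h1 := hucO.continuousOn_fderiv_of_isOpen hTo le_rfl
    have h2 := hucO.continuousOn
    have h3 : ContinuousOn A (tubeSet σ δ M) := hA.continuous.continuousOn
    have h4 : ContinuousOn (fun x => fderiv ℝ u x (1, 0)) (tubeSet σ δ M) := h1.clm_apply continuousOn_const
    have h5 : ContinuousOn (fun x => fderiv ℝ u x (0, 1)) (tubeSet σ δ M) := h1.clm_apply continuousOn_const
    have h6 : ContinuousOn (fun x => ((A x).1 : ℂ)) (tubeSet σ δ M) :=
      (Complex.continuous_ofReal.comp hA1.continuous).continuousOn
    have h7 : ContinuousOn (fun x => ((A x).2 : ℂ)) (tubeSet σ δ M) :=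
      (Complex.continuous_ofReal.comp hA2.continuous).continuousOn
    unfold mgNormSq
    fun_prop
  have hzero : ∀ s, mgNormSq b A u (M s) = 0 := by
    intro s
    have hd : HasFDerivAt u (fderiv ℝ u (Phi σ M (s, 0))) (Phi σ M (s, 0)) := by
      rw [Phi_zero]
      exact ((huc _ (hMmem s)).differentiableAt (by norm_num)).hasFDerivAt
    have ds : fderiv ℝ u (M s) (dPhis σ M (s, 0)) = Complex.I * (b : ℂ) * (g s : ℝ) * u (M s) := by
      have h1 : HasDerivAt (fun r => u (Phi σ M (r, 0))) _ s :=
        HasFDerivAt.comp_hasDerivAt (f := fun r => Phi σ M (r, 0)) s hd (Phi_hasDeriv_s T.sm s 0)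
      have h2 : (fun r => u (Phi σ M (r, 0))) = fun r => Complex.exp (((b * G r : ℝ) : ℂ) * Complex.I) := by
        funext r
        rw [hu r 0 (by simpa using T.hδ)]
        simp [hU]
      have h3 : HasDerivAt (fun r => Complex.exp (((b * G r : ℝ) : ℂ) * Complex.I))
          (Complex.exp (((b * G s : ℝ) : ℂ) * Complex.I) * (((b * g s : ℝ) : ℂ) * Complex.I)) s :=
        ((((hGd s).const_mul b).ofReal_comp).mul_const Complex.I).cexp
      rw [← h2] at h3
      have h4 := h1.unique h3
      rw [Phi_zero] at h4
      rw [h4, ← congrFun h2 s, Phi_zero]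
      push_cast; ring
    have dt : fderiv ℝ u (M s) (nrm σ M s) = Complex.I * (b : ℂ) * (α s : ℝ) * u (M s) := by
      have h1 : HasDerivAt (fun r => u (Phi σ M (s, r))) _ 0 :=
        HasFDerivAt.comp_hasDerivAt (f := fun r => Phi σ M (s, r)) 0 hd (Phi_hasDeriv_t s 0)
      have h2 : (fun r => u (Phi σ M (s, r))) =ᶠ[nhds 0]
          fun r => Complex.exp (((b * (G s + r * α s) : ℝ) : ℂ) * Complex.I) := by
        filter_upwards [Ioo_mem_nhds (by linarith [T.hδ] : -δ < 0) T.hδ] with r hr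
        rw [hu s r (abs_lt.2 hr)]
      have h3 : HasDerivAt (fun r : ℝ => Complex.exp (((b * (G s + r * α s) : ℝ) : ℂ) * Complex.I))
          (Complex.exp (((b * (G s + 0 * α s) : ℝ) : ℂ) * Complex.I) * (((b * (1 * α s) : ℝ) : ℂ) * Complex.I)) 0 :=
        ((((((hasDerivAt_id (0 : ℝ)).mul_const (α s)).const_add (G s)).const_mul b).ofReal_comp).mul_const Complex.I).cexp
      have h4 := h1.unique (h3.congr_of_eventuallyEq h2)
      rw [Phi_zero] at h4
      rw [h4, ← h2.eq_of_nhds, Phi_zero]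
      push_cast; ring
    have c1 := cov_eq b A u (M s) (dPhis σ M (s, 0))
    have c2 := cov_eq b A u (M s) (nrm σ M s)
    have e1 : g s = dot2 (A (M s)) (dPhis σ M (s, 0)) := by simp [hg, Phi_zero]
    rw [ds, e1, sub_self] at c1
    rw [dt, sub_self] at c2
    rw [mgNormSq]
    set z1 := fderiv ℝ u (M s) (1, 0) - Complex.I * (b : ℂ) * ((A (M s)).1 : ℂ) * u (M s)
    set z2 := fderiv ℝ u (M s) (0, 1) - Complex.I * (b : ℂ) * ((A (M s)).2 : ℂ) * u (M s)
    have un : (((deriv M s).1 : ℂ)) ^ 2 + ((deriv M s).2 : ℂ) ^ 2 = 1 := by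
      exact_mod_cast congrArg (fun x : ℝ => (x : ℂ)) (T.unit s)
    have hs2 : (σ : ℂ) ^ 2 = 1 := by rcases T.hσ with rfl | rfl <;> norm_num
    simp only [dPhis, nrm, zero_mul, sub_zero, add_zero] at c1 c2
    push_cast at c1 c2
    have hz1 : z1 = 0 := by
      linear_combination (-z1) * un - ((deriv M s).1 : ℂ) * c1 + (σ : ℂ) * ((deriv M s).2 : ℂ) * c2
        + (((deriv M s).1 : ℂ) * ((deriv M s).2 : ℂ) * z2 - ((deriv M s).2 : ℂ) ^ 2 * z1) * hs2
    have hz2 : z2 = 0 := by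
      linear_combination (-z2) * un - ((deriv M s).2 : ℂ) * c1 - (σ : ℂ) * ((deriv M s).1 : ℂ) * c2
        - (((deriv M s).1 : ℂ) ^ 2 * z2 - ((deriv M s).1 : ℂ) * ((deriv M s).2 : ℂ) * z1) * hs2
    rw [hz1, hz2]; simp
  -- open set where the density is small
  have hVo : IsOpen (tubeSet σ δ M ∩ mgNormSq b A u ⁻¹' Iio η) :=
    hcont.isOpen_inter_preimage hTo isOpen_Iio
  obtain ⟨ρ, hρ, hρs⟩ := T.compact_fr.exists_thickening_subset_open hVo (by
    rw [← T.fr]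
    rintro _ ⟨s, rfl⟩
    exact ⟨hMmem s, by simp [hzero s, hη]⟩)
  refine ⟨min (ρ / 2) δ, lt_min (by linarith) T.hδ, fun ε h0 h1 => ?_⟩
  have hcl : closure (OmegaEps Ω ε) ⊆ tubeSet σ δ M ∩ mgNormSq b A u ⁻¹' Iio η :=
    (T.closure_eps h0).trans ((Metric.thickening_mono (by
      have := min_le_left (ρ / 2) δ; linarith) _).trans hρs)
  have hsub := subset_closure.trans hcl
  have hone : ∀ x ∈ OmegaEps Ω ε, ‖u x‖ ^ 2 = 1 := by
    intro x hx
    obtain ⟨⟨s, t⟩, ⟨-, ht⟩, rfl⟩ := (hsub hx).1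
    rw [hu s t (abs_lt.2 ht)]
    simp only [hU]
    rw [Complex.norm_exp_ofReal_mul_I]; norm_num
  have hmeas : MeasurableSet (OmegaEps Ω ε) := (T.isOpen_eps ε).measurableSet
  have hintg : ∫ x in OmegaEps Ω ε, ‖u x‖ ^ 2 = volume.real (OmegaEps Ω ε) := by
    rw [setIntegral_congr_fun hmeas hone]; simp
  have hvp := T.vol_pos h0 (h1.le.trans (min_le_right _ _))
  refine lam_le (u := u) ⟨_, hTo, hcl.trans inter_subset_left, hucO⟩ (by rw [hintg]; exact hvp) ?_
  rw [hintg]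
  have hfin : volume (OmegaEps Ω ε) ≠ ⊤ := (T.finite_eps ε).ne
  calc (∫ x in OmegaEps Ω ε, mgNormSq b A u x) ≤ ∫ x in OmegaEps Ω ε, η := by
        refine setIntegral_mono_on ?_ (integrableOn_const hfin) hmeas (fun x hx => (hsub hx).2.le)
        have hcomp : IsCompact (closure (OmegaEps Ω ε)) :=
          Metric.isCompact_of_isClosed_isBounded isClosed_closure (T.bd.subset (eps_sub Ω ε)).closure
        exact ((hcont.mono (hcl.trans inter_subset_left)).integrableOn_compact hcomp).mono_set subset_closure
    _ = η * volume.real (OmegaEps Ω ε) := by simp [mul_comm]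

end STube

theorem integral_fderiv_zero {g : ℝ × ℝ → ℝ} (hg : ContDiff ℝ 1 g) (hc : HasCompactSupport g)
    (v : ℝ × ℝ) : ∫ x, fderiv ℝ g x v = 0 := by
  have hd : Continuous (fun x => fderiv ℝ g x v) :=
    (hg.continuous_fderiv (by norm_num)).clm_apply continuous_const
  have hdc : HasCompactSupport (fun x => fderiv ℝ g x v) := hc.fderiv_apply (𝕜 := ℝ) v
  have h := integral_mul_fderiv_eq_neg_fderiv_mul_of_integrable (μ := (volume : Measure (ℝ × ℝ)))
    (f := fun _ : ℝ × ℝ => (1 : ℝ)) (g := g) (v := v)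
    (by simp) (by simpa using hd.integrable_of_hasCompactSupport hdc)
    (by simpa using hg.continuous.integrable_of_hasCompactSupport hc)
    (fun x _ => differentiableAt_const _) (fun x _ => hg.differentiable (by norm_num) x)
  simpa using h

/-- a one dimensional cutoff -/
theorem exists_cut {r : ℝ} (hr : 0 < r) : ∃ f : ℝ → ℝ, ContDiff ℝ 1 f ∧ Monotone f ∧
    (∀ t ≤ r, f t = 0) ∧ (∀ t, 2 * r ≤ t → f t = 1) ∧ ∀ t, 0 ≤ f t := by
  refine ⟨fun t => Real.smoothTransition (t / r - 1), ?_, ?_, ?_, ?_, fun t => smoothTransition.nonneg _⟩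
  · exact (Real.smoothTransition.contDiff (n := 1)).comp (by fun_prop)
  · refine Real.smoothTransition.monotone.comp (fun a b h => ?_)
    gcongr
  · intro t ht
    apply smoothTransition.zero_of_nonpos
    have := (div_le_one hr).2 ht
    linarith
  · intro t ht
    apply smoothTransition.one_of_one_le
    have := (le_div_iff₀ hr).2 ht
    linarith

namespace STube
variable {Ω : Set (ℝ × ℝ)} {L K c δ σ : ℝ} {M : ℝ → ℝ × ℝ}

theorem exists_chi (T : STube Ω L K c δ σ M) {r : ℝ} (hr : 0 < r) (hrd : 4 * r < δ)
    {f : ℝ → ℝ} (hf : ContDiff ℝ 1 f) (f0 : ∀ t ≤ r, f t = 0) (f1 : ∀ t, 2 * r ≤ t → f t = 1)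
    (fn : ∀ t, 0 ≤ f t) :
    ∃ χ : ℝ × ℝ → ℝ, ContDiff ℝ 1 χ ∧ (∀ s t, |t| < δ → χ (Phi σ M (s, t)) = f t) ∧
      (∀ x ∉ Ω, χ x = 0) ∧ (∀ x, 0 ≤ χ x) ∧ ∀ x ∉ tubeSet σ δ M, fderiv ℝ χ x = 0 := by
  classical
  obtain ⟨u, hu, huc⟩ := T.descend T.hσ (fun p => f p.2) (hf.comp contDiff_snd) (fun s t => rfl)
  have hTo := T.isOpen_tubeSet T.hσ
  set χ : ℝ × ℝ → ℝ := fun x => if x ∈ tubeSet σ δ M then u x else if x ∈ Ω then 1 else 0 with hχ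
  have hin : ∀ s t, |t| < δ → χ (Phi σ M (s, t)) = f t := by
    intro s t ht
    have : Phi σ M (s, t) ∈ tubeSet σ δ M := ⟨(s, t), ⟨mem_univ _, abs_lt.1 ht⟩, rfl⟩
    simp only [hχ, this, if_true]
    exact hu s t ht
  have hoff : ∀ x ∉ Ω, χ x = 0 := by
    intro x hx
    by_cases h : x ∈ tubeSet σ δ M
    · obtain ⟨⟨s, t⟩, ⟨-, ht⟩, rfl⟩ := h
      rw [hin s t (abs_lt.2 ht)]
      apply f0
      by_contra hh
      exact hx (T.pos s t (by linarith) ht.2)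
    · simp [hχ, h, hx]
  have hloc : ∀ x ∉ tubeSet σ δ M, ∃ a : ℝ, χ =ᶠ[nhds x] fun _ => a := by
    intro x hx
    have hxf : x ∉ frontier Ω := by
      rw [← T.fr]
      rintro ⟨s, rfl⟩
      exact hx ⟨(s, 0), ⟨mem_univ _, by simp [T.hδ]⟩, Phi_zero M σ s⟩
    by_cases hxΩ : x ∈ Ω
    · refine ⟨1, ?_⟩
      have hK : IsCompact (Phi σ M '' (Icc 0 (2 * L) ×ˢ Icc (-(2 * r)) (2 * r))) :=
        (isCompact_Icc.prod isCompact_Icc).image (Phi_contDiff T.sm).continuous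
      have hxK : x ∉ Phi σ M '' (Icc 0 (2 * L) ×ˢ Icc (-(2 * r)) (2 * r)) := by
        rintro ⟨⟨s, t⟩, ⟨-, ht⟩, rfl⟩
        have h1 := ht.1
        have h2 := ht.2
        dsimp only at h1 h2
        exact hx ⟨(s, t), ⟨mem_univ _, ⟨by dsimp only; linarith, by dsimp only; linarith⟩⟩, rfl⟩
      filter_upwards [hK.isClosed.isOpen_compl.mem_nhds hxK, T.op.mem_nhds hxΩ] with y hy hyΩ
      by_cases h : y ∈ tubeSet σ δ M
      · obtain ⟨⟨s, t⟩, ⟨-, ht⟩, rfl⟩ := h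
        rw [hin s t (abs_lt.2 ht)]
        apply f1
        by_contra hh
        have ht0 : 0 < t := by
          by_contra h0
          exact T.npos s t ht.1 (by linarith) hyΩ
        obtain ⟨k, hk⟩ := Tube.exists_Ico T.hL s
        exact hy ⟨_, ⟨⟨hk.1, hk.2.le⟩, ⟨by dsimp only; linarith, by dsimp only; linarith⟩⟩, T.Phi_per σ s t k⟩
      · simp [hχ, h, hyΩ]
    · refine ⟨0, ?_⟩
      have hcl : x ∉ closure Ω := fun h => hxf (by rw [T.op.frontier_eq]; exact ⟨h, hxΩ⟩)
      filter_upwards [isClosed_closure.isOpen_compl.mem_nhds hcl] with y hy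
      exact hoff y (fun h => hy (subset_closure h))
  refine ⟨χ, ?_, hin, hoff, ?_, ?_⟩
  · rw [contDiff_iff_contDiffAt]
    intro x
    by_cases h : x ∈ tubeSet σ δ M
    · refine (huc x h).congr_of_eventuallyEq ?_
      filter_upwards [hTo.mem_nhds h] with y hy
      simp [hχ, hy]
    · obtain ⟨a, ha⟩ := hloc x h
      exact contDiffAt_const.congr_of_eventuallyEq ha
  · intro x
    by_cases h : x ∈ tubeSet σ δ M
    · obtain ⟨⟨s, t⟩, ⟨-, ht⟩, rfl⟩ := h
      rw [hin s t (abs_lt.2 ht)]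
      exact fn t
    · simp only [hχ, h, if_false]
      split_ifs <;> norm_num
  · intro x h
    obtain ⟨a, ha⟩ := hloc x h
    rw [ha.fderiv_eq]; simp

/-- fundamental strip -/
theorem injOn_strip (T : STube Ω L K c δ σ M) :
    InjOn (Phi σ M) (Ico 0 (2 * L) ×ˢ Ioo (-δ) δ) := by
  rintro ⟨s, t⟩ ⟨hs, ht⟩ ⟨s', t'⟩ ⟨hs', ht'⟩ h
  obtain ⟨e, k, hk⟩ := T.inj T.hσ (abs_lt.2 ht).le (abs_lt.2 ht').le h
  have hL := T.hL
  dsimp only at hs hs'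
  have k0 : k = 0 := by
    have h1 : (k : ℝ) * (2 * L) < 1 * (2 * L) := by linarith [hs.2, hs'.1]
    have h2 : (-1 : ℝ) * (2 * L) < k * (2 * L) := by linarith [hs'.2, hs.1]
    have h3 : (k : ℝ) < 1 := lt_of_mul_lt_mul_right h1 (by linarith)
    have h4 : (-1 : ℝ) < k := lt_of_mul_lt_mul_right h2 (by linarith)
    have h5 : k < 1 := by exact_mod_cast h3
    have h6 : -1 < k := by exact_mod_cast h4
    omega
  rw [k0] at hk
  simp at hk
  have e' : t = t' := e
  rw [e', hk]

theorem strip_image (T : STube Ω L K c δ σ M) :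
    Phi σ M '' (Ico 0 (2 * L) ×ˢ Ioo (-δ) δ) = tubeSet σ δ M := by
  ext x
  constructor
  · rintro ⟨p, ⟨-, hp⟩, rfl⟩
    exact ⟨p, ⟨mem_univ _, hp⟩, rfl⟩
  · rintro ⟨⟨s, t⟩, ⟨-, hp⟩, rfl⟩
    obtain ⟨k, hk⟩ := Tube.exists_Ico T.hL s
    exact ⟨(s + k * (2 * L), t), ⟨hk, hp⟩, T.Phi_per σ s t k⟩

theorem integral_chi (T : STube Ω L K c δ σ M) {A : ℝ × ℝ → ℝ × ℝ} (hA : ContDiff ℝ 1 A)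
    (hcurl : ∀ x ∈ Ω, curl2 A x = 1) {χ : ℝ × ℝ → ℝ} (hχ : ContDiff ℝ 1 χ)
    {f : ℝ → ℝ} (hf : ContDiff ℝ 1 f) (hin : ∀ s t, |t| < δ → χ (Phi σ M (s, t)) = f t)
    (hoff : ∀ x ∉ Ω, χ x = 0) (hfd : ∀ x ∉ tubeSet σ δ M, fderiv ℝ χ x = 0) :
    ∫ x, χ x = σ * ∫ t in Ioo (-δ) δ, deriv f t * circ A σ M L t := by
  have hA1 : ContDiff ℝ 1 (fun x => (A x).1) := hA.fst
  have hA2 : ContDiff ℝ 1 (fun x => (A x).2) := hA.snd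
  have hcs : HasCompactSupport χ := by
    refine HasCompactSupport.intro
      (Metric.isCompact_of_isClosed_isBounded isClosed_closure T.bd.closure) (fun x hx => ?_)
    exact hoff x (fun h => hx (subset_closure h))
  set D : ℝ × ℝ → ℝ := fun x => fderiv ℝ χ x (1, 0) * (A x).2 - fderiv ℝ χ x (0, 1) * (A x).1 with hD
  have hcd : ∀ v, Continuous (fun x => fderiv ℝ χ x v) := fun v =>
    (hχ.continuous_fderiv (by norm_num)).clm_apply continuous_const
  have hcdc : ∀ v, HasCompactSupport (fun x => fderiv ℝ χ x v) := fun v => hcs.fderiv_apply (𝕜 := ℝ) v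
  have i1 := integral_fderiv_zero (hχ.mul hA2) hcs.mul_right (1, 0)
  have i2 := integral_fderiv_zero (hχ.mul hA1) hcs.mul_right (0, 1)
  have hpt : ∀ x, χ x = (fderiv ℝ (fun x => χ x * (A x).2) x (1, 0)
      - fderiv ℝ (fun x => χ x * (A x).1) x (0, 1)) - D x := by
    intro x
    have e1 := fderiv_fun_mul (hχ.differentiable (by norm_num) x) (hA2.differentiable (by norm_num) x)
    have e2 := fderiv_fun_mul (hχ.differentiable (by norm_num) x) (hA1.differentiable (by norm_num) x)
    rw [e1, e2]
    have : χ x = χ x * curl2 A x := by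
      by_cases h : x ∈ Ω
      · rw [hcurl x h, mul_one]
      · simp [hoff x h]
    conv_lhs => rw [this]
    simp only [hD, curl2, add_apply, smul_apply, smul_eq_mul]
    ring
  have c1 : Integrable (fun x => fderiv ℝ (fun x => χ x * (A x).2) x (1, 0)) :=
    (((hχ.mul hA2).continuous_fderiv (by norm_num)).clm_apply
      continuous_const).integrable_of_hasCompactSupport
      (HasCompactSupport.fderiv_apply (𝕜 := ℝ) (hcs.mul_right) _)
  have c2 : Integrable (fun x => fderiv ℝ (fun x => χ x * (A x).1) x (0, 1)) :=
    (((hχ.mul hA1).continuous_fderiv (by norm_num)).clm_apply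
      continuous_const).integrable_of_hasCompactSupport
      (HasCompactSupport.fderiv_apply (𝕜 := ℝ) (hcs.mul_right) _)
  have c3 : Integrable D := by
    refine Integrable.sub ?_ ?_
    · exact ((hcd _).mul hA2.continuous).integrable_of_hasCompactSupport (hcdc _).mul_right
    · exact ((hcd _).mul hA1.continuous).integrable_of_hasCompactSupport (hcdc _).mul_right
  have hintg : ∫ x, χ x = - ∫ x, D x := by
    have h : ∫ x, χ x = ∫ x, ((fderiv ℝ (fun x => χ x * (A x).2) x (1, 0)
      - fderiv ℝ (fun x => χ x * (A x).1) x (0, 1)) - D x) := integral_congr_ae (Filter.Eventually.of_forall hpt)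
    have c12 : Integrable (fun x => fderiv ℝ (fun x => χ x * (A x).2) x (1, 0)
      - fderiv ℝ (fun x => χ x * (A x).1) x (0, 1)) := c1.sub c2
    rw [h, integral_sub c12 c3, integral_sub c1 c2]
    have i1' : ∫ x, fderiv ℝ (fun x => χ x * (A x).2) x (1, 0) = 0 := i1
    have i2' : ∫ x, fderiv ℝ (fun x => χ x * (A x).1) x (0, 1) = 0 := i2
    rw [i1', i2']; ring
  have hDset : ∫ x, D x = ∫ x in tubeSet σ δ M, D x := by
    refine (setIntegral_eq_integral_of_forall_compl_eq_zero (fun x hx => ?_)).symm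
    simp [hD, hfd x hx]
  have hms : MeasurableSet (Ico 0 (2 * L) ×ˢ Ioo (-δ) δ) := measurableSet_Ico.prod measurableSet_Ioo
  rw [hintg, hDset, ← T.strip_image, integral_image_eq_integral_abs_det_fderiv_smul volume hms
    (fun p _ => (Phi_hasFDerivAt T.sm p).hasFDerivWithinAt) T.injOn_strip]
  have hker : ∀ p ∈ Ico 0 (2 * L) ×ˢ Ioo (-δ) δ, |(dPhi σ M p).det| • D (Phi σ M p) =
      -(σ * (deriv f p.2 * dot2 (A (Phi σ M p)) (dPhis σ M p))) := by
    rintro ⟨s, t⟩ ⟨-, ht⟩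
    dsimp only at ht
    have hd : HasFDerivAt χ (fderiv ℝ χ (Phi σ M (s, t))) (Phi σ M (s, t)) :=
      (hχ.differentiable (by norm_num) _).hasFDerivAt
    have ds : fderiv ℝ χ (Phi σ M (s, t)) (dPhis σ M (s, t)) = 0 := by
      have h1 : HasDerivAt (fun r => χ (Phi σ M (r, t))) _ s :=
        HasFDerivAt.comp_hasDerivAt (f := fun r => Phi σ M (r, t)) s hd (Phi_hasDeriv_s T.sm s t)
      have h2 : (fun r => χ (Phi σ M (r, t))) = fun r => f t := funext fun r => hin r t (abs_lt.2 ht)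
      rw [h2] at h1
      exact h1.unique (hasDerivAt_const _ _)
    have dt : fderiv ℝ χ (Phi σ M (s, t)) (nrm σ M s) = deriv f t := by
      have h1 : HasDerivAt (fun r => χ (Phi σ M (s, r))) _ t :=
        HasFDerivAt.comp_hasDerivAt (f := fun r => Phi σ M (s, r)) t hd (Phi_hasDeriv_t s t)
      have h2 : f =ᶠ[nhds t] (fun r => χ (Phi σ M (s, r))) := by
        filter_upwards [Ioo_mem_nhds ht.1 ht.2] with r hr
        exact (hin s r (abs_lt.2 hr)).symm
      exact (h1.congr_of_eventuallyEq h2).unique (hf.differentiable (by norm_num) t).hasDerivAt |>.symm ▸ rfl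
    rw [T.abs_det_bounds T.hσ (abs_lt.2 ht).le, dPhi_det]
    have lin : ∀ w : ℝ × ℝ, fderiv ℝ χ (Phi σ M (s, t)) w =
        w.1 * fderiv ℝ χ (Phi σ M (s, t)) (1, 0) + w.2 * fderiv ℝ χ (Phi σ M (s, t)) (0, 1) := by
      intro w
      have hq : w = w.1 • ((1 : ℝ), (0 : ℝ)) + w.2 • ((0 : ℝ), (1 : ℝ)) := by ext <;> simp
      conv_lhs => rw [hq, map_add, map_smul, map_smul]
      simp
    rw [lin] at ds dt
    simp only [hD, dot2, smul_eq_mul]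
    rw [← dt]
    linear_combination (σ * ((A (Phi σ M (s, t))).1 * (nrm σ M s).1 + (A (Phi σ M (s, t))).2 * (nrm σ M s).2)) * ds
  rw [setIntegral_congr_fun hms hker, integral_neg, integral_const_mul, neg_neg]
  congr 1
  have hcont : Continuous (fun p : ℝ × ℝ => deriv f p.2 * dot2 (A (Phi σ M p)) (dPhis σ M p)) :=
    ((hf.continuous_deriv le_rfl).comp continuous_snd).mul (integrand_continuous T.sm hA.continuous)
  have hio : IntegrableOn (fun p : ℝ × ℝ => deriv f p.2 * dot2 (A (Phi σ M p)) (dPhis σ M p))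
      (Ico 0 (2 * L) ×ˢ Ioo (-δ) δ) :=
    (hcont.continuousOn.integrableOn_compact (isCompact_Icc.prod isCompact_Icc)).mono_set
      (prod_mono Ico_subset_Icc_self Ioo_subset_Icc_self)
  have hpr : (volume : Measure (ℝ × ℝ)).restrict (Ico 0 (2 * L) ×ˢ Ioo (-δ) δ) =
      (volume.restrict (Ico 0 (2 * L))).prod (volume.restrict (Ioo (-δ) δ)) :=
    (Measure.prod_restrict _ _).symm
  unfold IntegrableOn at hio
  rw [hpr] at hio ⊢
  rw [integral_prod_symm _ hio]
  refine integral_congr_ae (Filter.Eventually.of_forall fun t => ?_)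
  dsimp only
  rw [integral_const_mul, circ, intervalIntegral.integral_of_le (by linarith [T.hL]),
    integral_Ico_eq_integral_Ioo, integral_Ioc_eq_integral_Ioo]

theorem circ_ne_zero (T : STube Ω L K c δ σ M) {A : ℝ × ℝ → ℝ × ℝ} (hA : ContDiff ℝ 1 A)
    (hcurl : ∀ x ∈ Ω, curl2 A x = 1) : circ A σ M L 0 ≠ 0 := by
  intro h0
  have hδ := T.hδ
  set V := Phi σ M '' (univ ×ˢ Ioo (δ / 2) δ) with hV
  have hVo : IsOpen V := T.isOpen_image T.hσ (isOpen_univ.prod isOpen_Ioo) (fun p hp => by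
    have := hp.2.1; have := hp.2.2
    rw [abs_le]; constructor <;> linarith)
  have hVΩ : V ⊆ Ω := by
    rintro _ ⟨⟨s, t⟩, ⟨-, h1, h2⟩, rfl⟩
    dsimp only at h1 h2
    exact T.pos s t (by linarith) h2
  have hVn : V.Nonempty := ⟨_, (0, 3 * δ / 4), ⟨mem_univ _, by dsimp only; linarith, by dsimp only; linarith⟩, rfl⟩
  have hVf : volume V ≠ ⊤ := ((T.bd.subset hVΩ).measure_lt_top).ne
  have hVp : 0 < volume.real V := ENNReal.toReal_pos (hVo.measure_pos volume hVn).ne' hVf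
  have hcc := circ_continuous (σ := σ) (L := L) T.sm hA.continuous
  obtain ⟨ρ, hρ, hρs⟩ := Metric.continuous_iff.1 hcc 0 (volume.real V / 2) (by linarith)
  obtain ⟨r, hr, hr1, hr2⟩ : ∃ r > 0, 4 * r < δ ∧ 2 * r < ρ :=
    ⟨min δ ρ / 8, by positivity, by have := min_le_left δ ρ; have : 0 < min δ ρ := by positivity
                                    linarith [min_le_left δ ρ],
      by have : 0 < min δ ρ := by positivity
         linarith [min_le_right δ ρ]⟩
  obtain ⟨f, hf, hfm, f0, f1, fn⟩ := exists_cut hr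
  obtain ⟨χ, hχ, hin, hoff, hnn, hfd⟩ := T.exists_chi hr hr1 hf f0 f1 fn
  have hI := T.integral_chi hA hcurl hχ hf hin hoff hfd
  have hcs : HasCompactSupport χ := by
    refine HasCompactSupport.intro
      (Metric.isCompact_of_isClosed_isBounded isClosed_closure T.bd.closure) (fun x hx => ?_)
    exact hoff x (fun h => hx (subset_closure h))
  have hχi : Integrable χ := hχ.continuous.integrable_of_hasCompactSupport hcs
  have hlow : volume.real V ≤ ∫ x, χ x := by
    calc volume.real V = ∫ x in V, (1 : ℝ) := by simp
      _ = ∫ x in V, χ x := by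
        refine setIntegral_congr_fun hVo.measurableSet ?_
        rintro _ ⟨⟨s, t⟩, ⟨-, h1, h2⟩, rfl⟩
        dsimp only at h1 h2
        dsimp only
        rw [hin s t (by rw [abs_lt]; constructor <;> linarith), f1 t (by linarith)]
      _ ≤ ∫ x, χ x := setIntegral_le_integral hχi (Filter.Eventually.of_forall hnn)
  have hdn : ∀ t, 0 ≤ deriv f t := fun t => hfm.deriv_nonneg
  have hptw : ∀ t, ‖deriv f t * circ A σ M L t‖ ≤ deriv f t * (volume.real V / 2) := by
    intro t
    rw [norm_mul, Real.norm_of_nonneg (hdn t)]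
    rcases lt_or_ge t r with h | h
    · have : f =ᶠ[nhds t] fun _ => 0 := by
        filter_upwards [Iio_mem_nhds h] with y hy using f0 y (le_of_lt hy)
      rw [this.deriv_eq]; simp
    rcases lt_or_ge (2 * r) t with h' | h'
    · have : f =ᶠ[nhds t] fun _ => 1 := by
        filter_upwards [Ioi_mem_nhds h'] with y hy using f1 y (le_of_lt hy)
      rw [this.deriv_eq]; simp
    · have := hρs t (by rw [dist_zero_right, Real.norm_eq_abs, abs_of_pos (by linarith)]; linarith)
      rw [h0, dist_zero_right] at this
      exact mul_le_mul_of_nonneg_left this.le (hdn t)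
  have hdf : ∫ t in Ioo (-δ) δ, deriv f t = 1 := by
    rw [← integral_Ioc_eq_integral_Ioo, ← intervalIntegral.integral_of_le (by linarith),
      intervalIntegral.integral_deriv_eq_sub (fun x _ => hf.differentiable (by norm_num) x)
        ((hf.continuous_deriv le_rfl).intervalIntegrable _ _), f0 (-δ) (by linarith), f1 δ (by linarith)]
    norm_num
  have hup : |∫ x, χ x| ≤ volume.real V / 2 := by
    rw [hI, abs_mul, show |σ| = 1 by rcases T.hσ with h | h <;> simp [h], one_mul]
    have hci : IntegrableOn (fun t => deriv f t * (volume.real V / 2)) (Ioo (-δ) δ) :=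
      ((((hf.continuous_deriv le_rfl).mul continuous_const)).continuousOn.integrableOn_compact
        isCompact_Icc).mono_set Ioo_subset_Icc_self
    have := norm_integral_le_of_norm_le hci (Filter.Eventually.of_forall hptw)
    rw [integral_mul_const, hdf, one_mul] at this
    exact this
  have := le_abs_self (∫ x, χ x)
  linarith

end STube

theorem cs_interval {g : ℝ → ℝ} (hg : Continuous g) {x y : ℝ} (hxy : x ≤ y) :
    (∫ t in x..y, g t) ^ 2 ≤ (y - x) * ∫ t in x..y, g t ^ 2 := by
  rcases eq_or_lt_of_le hxy with rfl | h
  · simp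
  set I := ∫ t in x..y, g t with hI
  have hl : 0 < y - x := by linarith
  have h0 : 0 ≤ ∫ t in x..y, ((y - x) * g t - I) ^ 2 :=
    intervalIntegral.integral_nonneg hxy fun t _ => sq_nonneg _
  have e : ∫ t in x..y, ((y - x) * g t - I) ^ 2 =
      (y - x) ^ 2 * (∫ t in x..y, g t ^ 2) - 2 * (y - x) * I * I + (y - x) * I ^ 2 := by
    have i1 : IntervalIntegrable (fun t => (y - x) ^ 2 * g t ^ 2) volume x y :=
      (continuous_const.mul (hg.pow 2)).intervalIntegrable _ _
    have i2 : IntervalIntegrable (fun t => 2 * (y - x) * I * g t) volume x y :=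
      (continuous_const.mul hg).intervalIntegrable _ _
    have i3 : IntervalIntegrable (fun t => (y - x) ^ 2 * g t ^ 2 - 2 * (y - x) * I * g t) volume x y := i1.sub i2
    have : ∀ t, ((y - x) * g t - I) ^ 2 = ((y - x) ^ 2 * g t ^ 2 - 2 * (y - x) * I * g t) + I ^ 2 := by
      intro t; ring
    simp_rw [this]
    rw [intervalIntegral.integral_add i3 (by simp), intervalIntegral.integral_sub i1 i2,
      intervalIntegral.integral_const_mul, intervalIntegral.integral_const_mul]
    simp [← hI]
  rw [e] at h0
  have : 0 ≤ (y - x) * ((y - x) * (∫ t in x..y, g t ^ 2) - I ^ 2) := by nlinarith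
  have := nonneg_of_mul_nonneg_right this hl
  linarith

/-- gauge transform on an interval -/
theorem gauge_le {v v' : ℝ → ℂ} {a : ℝ → ℝ} (hv : ∀ s, HasDerivAt v (v' s) s) (hv' : Continuous v')
    (ha : Continuous a) {x y : ℝ} (hxy : x ≤ y) :
    ‖v y * Complex.exp (-(Complex.I * ((∫ s in x..y, a s : ℝ) : ℂ))) - v x‖ ≤
      ∫ s in x..y, ‖v' s - Complex.I * (a s : ℂ) * v s‖ := by
  have hvc : Continuous v := continuous_iff_continuousAt.2 fun s => (hv s).continuousAt
  set F : ℝ → ℝ := fun s => ∫ r in x..s, a r with hF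
  have hFd : ∀ s, HasDerivAt F (a s) s := fun s =>
    intervalIntegral.integral_hasDerivAt_right (ha.intervalIntegrable _ _)
      (ha.stronglyMeasurableAtFilter _ _) ha.continuousAt
  have hFc : Continuous F := continuous_iff_continuousAt.2 fun s => (hFd s).continuousAt
  have hac : Continuous (fun s => (a s : ℂ)) := Complex.continuous_ofReal.comp ha
  have hFcc : Continuous (fun s => (F s : ℂ)) := Complex.continuous_ofReal.comp hFc
  set w : ℝ → ℂ := fun s => v s * Complex.exp (-(Complex.I * (F s : ℂ))) with hw
  set w' : ℝ → ℂ := fun s => (v' s - Complex.I * (a s : ℂ) * v s) * Complex.exp (-(Complex.I * (F s : ℂ))) with hw'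
  have hwd : ∀ s, HasDerivAt w (w' s) s := by
    intro s
    have h1 : HasDerivAt (fun s => Complex.exp (-(Complex.I * (F s : ℂ))))
        (Complex.exp (-(Complex.I * (F s : ℂ))) * -(Complex.I * (a s : ℂ))) s :=
      ((((hFd s).ofReal_comp).const_mul Complex.I).neg).cexp
    have h2 := (hv s).mul h1
    convert! h2 using 1
    simp only [hw']
    ring
  have hwc : Continuous w' := by fun_prop
  have hn : ∀ s, ‖w' s‖ = ‖v' s - Complex.I * (a s : ℂ) * v s‖ := by
    intro s
    simp only [hw', norm_mul]
    rw [show -(Complex.I * (F s : ℂ)) = ((-F s : ℝ) : ℂ) * Complex.I by push_cast; ring,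
      Complex.norm_exp_ofReal_mul_I, mul_one]
  have hft := intervalIntegral.integral_eq_sub_of_hasDerivAt (fun s _ => hwd s)
    (hwc.intervalIntegrable x y)
  have hx : w x = v x := by simp [hw, hF]
  rw [hx] at hft
  have := intervalIntegral.norm_integral_le_integral_norm (f := w') (μ := volume) hxy
  rw [hft] at this
  simp_rw [hn] at this
  exact this

namespace STube
variable {Ω : Set (ℝ × ℝ)} {L K c δ σ : ℝ} {M : ℝ → ℝ × ℝ}

theorem mg_continuous {A : ℝ × ℝ → ℝ × ℝ} (hA : Continuous A) {u : ℝ × ℝ → ℂ}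
    (hu : ContDiff ℝ 1 u) (b : ℝ) : Continuous (mgNormSq b A u) := by
  have h1 := hu.continuous_fderiv (by norm_num)
  have h2 := hu.continuous
  have h4 : Continuous (fun x => fderiv ℝ u x (1, 0)) := h1.clm_apply continuous_const
  have h5 : Continuous (fun x => fderiv ℝ u x (0, 1)) := h1.clm_apply continuous_const
  have h6 : Continuous (fun x => ((A x).1 : ℂ)) := Complex.continuous_ofReal.comp hA.fst
  have h7 : Continuous (fun x => ((A x).2 : ℂ)) := Complex.continuous_ofReal.comp hA.snd
  unfold mgNormSq
  fun_prop

theorem cov_bound {A : ℝ × ℝ → ℝ × ℝ} (b : ℝ) (u : ℝ × ℝ → ℂ) (x w : ℝ × ℝ) :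
    ‖fderiv ℝ u x w - Complex.I * ((b * dot2 (A x) w : ℝ) : ℂ) * u x‖ ^ 2 ≤
      (w.1 ^ 2 + w.2 ^ 2) * mgNormSq b A u x := by
  have := cov_le b A u x w
  convert this using 3
  push_cast; ring

theorem step1 (T : STube Ω L K c δ σ M) {A : ℝ × ℝ → ℝ × ℝ} (hA : Continuous A) {u : ℝ × ℝ → ℂ}
    (hu : ContDiff ℝ 1 u) {b t : ℝ} (ht : |t| ≤ δ)
    (hph : 1 ≤ ‖Complex.exp (-(Complex.I * ((b * circ A σ M L t : ℝ) : ℂ))) - 1‖) (s : ℝ) :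
    ‖u (Phi σ M (s, t))‖ ^ 2 ≤ 16 * L * ∫ r in (0 : ℝ)..2 * L, mgNormSq b A u (Phi σ M (r, t)) := by
  have hL := T.hL
  have hPc : Continuous (fun r => Phi σ M (r, t)) :=
    (Phi_contDiff T.sm).continuous.comp (continuous_id.prodMk continuous_const)
  have hdc : Continuous (fun r => dPhis σ M (r, t)) :=
    (dPhis_continuous T.sm).comp (continuous_id.prodMk continuous_const)
  set v' : ℝ → ℂ := fun r => fderiv ℝ u (Phi σ M (r, t)) (dPhis σ M (r, t)) with hv'
  set a : ℝ → ℝ := fun r => b * dot2 (A (Phi σ M (r, t))) (dPhis σ M (r, t)) with ha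
  have hd : ∀ r, HasDerivAt (fun r => u (Phi σ M (r, t))) (v' r) r := fun r =>
    HasFDerivAt.comp_hasDerivAt (f := fun r => Phi σ M (r, t)) r
      (hu.differentiable (by norm_num) _).hasFDerivAt (Phi_hasDeriv_s T.sm r t)
  have hv'c : Continuous v' := ((hu.continuous_fderiv (by norm_num)).comp hPc).clm_apply hdc
  have hac : Continuous a :=
    continuous_const.mul ((integrand_continuous T.sm hA).comp (continuous_id.prodMk continuous_const))
  have haper : Function.Periodic a (2 * L) := fun r => by simp only [ha, T.Phi_per1, T.dPhis_per1]
  have hintg : ∫ r in s..(s + 2 * L), a r = b * circ A σ M L t := by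
    have := haper.intervalIntegral_add_eq s 0
    rw [zero_add] at this
    rw [this, circ, ← intervalIntegral.integral_const_mul]
  set n : ℝ → ℝ := fun r => ‖v' r - Complex.I * (a r : ℂ) * u (Phi σ M (r, t))‖ with hn
  have hnc : Continuous n := by
    have h1 : Continuous (fun r => (a r : ℂ)) := Complex.continuous_ofReal.comp hac
    have h2 : Continuous (fun r => u (Phi σ M (r, t))) := hu.continuous.comp hPc
    fun_prop
  have hg : ‖u (Phi σ M (s + 2 * L, t)) * Complex.exp (-(Complex.I * ((∫ r in s..(s + 2 * L), a r : ℝ) : ℂ)))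
      - u (Phi σ M (s, t))‖ ≤ ∫ r in s..(s + 2 * L), n r :=
    gauge_le hd hv'c hac (by linarith : s ≤ s + 2 * L)
  have hnper : Function.Periodic n (2 * L) := fun r => by
    simp only [hn, hv', ha, T.Phi_per1, T.dPhis_per1]
  rw [hintg, T.Phi_per1, hnper.intervalIntegral_add_eq s 0, zero_add] at hg
  have hu1 : ‖u (Phi σ M (s, t))‖ ≤ ∫ r in (0 : ℝ)..2 * L, n r := by
    refine le_trans ?_ hg
    have : u (Phi σ M (s, t)) * Complex.exp (-(Complex.I * ((b * circ A σ M L t : ℝ) : ℂ))) - u (Phi σ M (s, t))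
      = u (Phi σ M (s, t)) * (Complex.exp (-(Complex.I * ((b * circ A σ M L t : ℝ) : ℂ))) - 1) := by ring
    rw [this, norm_mul]
    exact le_mul_of_one_le_right (norm_nonneg _) hph
  have hmc : Continuous (fun r => mgNormSq b A u (Phi σ M (r, t))) := (mg_continuous hA hu b).comp hPc
  calc ‖u (Phi σ M (s, t))‖ ^ 2 ≤ (∫ r in (0 : ℝ)..2 * L, n r) ^ 2 := by gcongr
    _ ≤ (2 * L - 0) * ∫ r in (0 : ℝ)..2 * L, n r ^ 2 := cs_interval hnc (by linarith)
    _ ≤ (2 * L - 0) * ∫ r in (0 : ℝ)..2 * L, 8 * mgNormSq b A u (Phi σ M (r, t)) := by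
      refine mul_le_mul_of_nonneg_left ?_ (by linarith)
      refine intervalIntegral.integral_mono_on (by linarith) ((hnc.pow 2).intervalIntegrable _ _)
        ((continuous_const.mul hmc).intervalIntegrable _ _) (fun r _ => ?_)
      refine (cov_bound b u (Phi σ M (r, t)) (dPhis σ M (r, t))).trans ?_
      exact mul_le_mul_of_nonneg_right (T.dPhis_bound T.hσ ht) (mg_nonneg _ _ _ _)
    _ = _ := by rw [intervalIntegral.integral_const_mul]; ring

theorem step2 (T : STube Ω L K c δ σ M) {A : ℝ × ℝ → ℝ × ℝ} (hA : Continuous A) {u : ℝ × ℝ → ℂ}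
    (hu : ContDiff ℝ 1 u) (b s : ℝ) {t : ℝ} (ht : 0 ≤ t) :
    ‖u (Phi σ M (s, t))‖ ^ 2 ≤ 2 * ‖u (Phi σ M (s, t / 2))‖ ^ 2 +
      t * ∫ r in (t / 2)..t, mgNormSq b A u (Phi σ M (s, r)) := by
  have hPc : Continuous (fun r => Phi σ M (s, r)) :=
    (Phi_contDiff T.sm).continuous.comp (continuous_const.prodMk continuous_id)
  set v' : ℝ → ℂ := fun r => fderiv ℝ u (Phi σ M (s, r)) (nrm σ M s) with hv'
  set a : ℝ → ℝ := fun r => b * dot2 (A (Phi σ M (s, r))) (nrm σ M s) with ha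
  have hd : ∀ r, HasDerivAt (fun r => u (Phi σ M (s, r))) (v' r) r := fun r =>
    HasFDerivAt.comp_hasDerivAt (f := fun r => Phi σ M (s, r)) r
      (hu.differentiable (by norm_num) _).hasFDerivAt (Phi_hasDeriv_t s r)
  have hv'c : Continuous v' := ((hu.continuous_fderiv (by norm_num)).comp hPc).clm_apply continuous_const
  have hac : Continuous a := by
    have := hA.comp hPc
    exact continuous_const.mul ((this.fst.mul continuous_const).add (this.snd.mul continuous_const))
  set n : ℝ → ℝ := fun r => ‖v' r - Complex.I * (a r : ℂ) * u (Phi σ M (s, r))‖ with hn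
  have hnc : Continuous n := by
    have h1 : Continuous (fun r => (a r : ℂ)) := Complex.continuous_ofReal.comp hac
    have h2 : Continuous (fun r => u (Phi σ M (s, r))) := hu.continuous.comp hPc
    fun_prop
  have hg : ‖u (Phi σ M (s, t)) * Complex.exp (-(Complex.I * ((∫ r in (t / 2)..t, a r : ℝ) : ℂ)))
      - u (Phi σ M (s, t / 2))‖ ≤ ∫ r in (t / 2)..t, n r :=
    gauge_le hd hv'c hac (by linarith : t / 2 ≤ t)
  have hmc : Continuous (fun r => mgNormSq b A u (Phi σ M (s, r))) := (mg_continuous hA hu b).comp hPc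
  have hI : (∫ r in (t / 2)..t, n r) ^ 2 ≤ (t / 2) * ∫ r in (t / 2)..t, mgNormSq b A u (Phi σ M (s, r)) := by
    calc _ ≤ (t - t / 2) * ∫ r in (t / 2)..t, n r ^ 2 := cs_interval hnc (by linarith)
      _ ≤ (t - t / 2) * ∫ r in (t / 2)..t, mgNormSq b A u (Phi σ M (s, r)) := by
        refine mul_le_mul_of_nonneg_left ?_ (by linarith)
        refine intervalIntegral.integral_mono_on (by linarith) ((hnc.pow 2).intervalIntegrable _ _)
          (hmc.intervalIntegrable _ _) (fun r _ => ?_)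
        refine (cov_bound b u (Phi σ M (s, r)) (nrm σ M s)).trans ?_
        have : (nrm σ M s).1 ^ 2 + (nrm σ M s).2 ^ 2 = 1 := by
          have := T.unit s
          simp only [nrm]
          rcases T.hσ with h | h <;> rw [h] <;> linarith
        rw [this, one_mul]
      _ = _ := by ring
  set z := u (Phi σ M (s, t)) * Complex.exp (-(Complex.I * ((∫ r in (t / 2)..t, a r : ℝ) : ℂ))) with hz
  have hzn : ‖z‖ = ‖u (Phi σ M (s, t))‖ := by
    rw [hz, norm_mul, show ∀ x : ℝ, -(Complex.I * (x : ℂ)) = ((-x : ℝ) : ℂ) * Complex.I by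
      intro x; push_cast; ring, Complex.norm_exp_ofReal_mul_I, mul_one]
  have h3 : ‖z‖ ≤ ‖u (Phi σ M (s, t / 2))‖ + ∫ r in (t / 2)..t, n r := by
    have := norm_sub_norm_le z (u (Phi σ M (s, t / 2)))
    linarith
  rw [hzn] at h3
  have h4 : ‖u (Phi σ M (s, t))‖ ^ 2 ≤ (‖u (Phi σ M (s, t / 2))‖ + ∫ r in (t / 2)..t, n r) ^ 2 := by gcongr
  nlinarith [sq_nonneg (‖u (Phi σ M (s, t / 2))‖ - ∫ r in (t / 2)..t, n r)]

/-- the thin domain in coordinates -/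
def strip (Ω : Set (ℝ × ℝ)) (L ε σ : ℝ) (M : ℝ → ℝ × ℝ) : Set (ℝ × ℝ) :=
  (Ico 0 (2 * L) ×ˢ Ioo 0 (2 * ε)) ∩ Phi σ M ⁻¹' (OmegaEps Ω ε)

theorem strip_meas (T : STube Ω L K c δ σ M) (ε : ℝ) : MeasurableSet (strip Ω L ε σ M) :=
  (measurableSet_Ico.prod measurableSet_Ioo).inter
    ((T.isOpen_eps ε).preimage (Phi_contDiff T.sm).continuous).measurableSet

theorem box_int {f : ℝ × ℝ → ℝ} (hf : Continuous f) (L ε : ℝ) :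
    IntegrableOn f (Ico 0 (2 * L) ×ˢ Ioo 0 (2 * ε)) :=
  (hf.continuousOn.integrableOn_compact (isCompact_Icc.prod isCompact_Icc)).mono_set
    (prod_mono Ico_subset_Icc_self Ioo_subset_Icc_self)

theorem strip_cov (T : STube Ω L K c δ σ M) {ε : ℝ} (hε : 2 * ε ≤ δ) {F : ℝ × ℝ → ℝ}
    (hF : Continuous F) (hF0 : ∀ x, 0 ≤ F x) :
    (∫ x in OmegaEps Ω ε, F x) ≤ 2 * ∫ p in strip Ω L ε σ M, F (Phi σ M p) ∧
    (∫ p in strip Ω L ε σ M, F (Phi σ M p)) ≤ 2 * ∫ x in OmegaEps Ω ε, F x := by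
  have him : OmegaEps Ω ε = Phi σ M '' strip Ω L ε σ M := by
    ext x
    constructor
    · intro hx
      obtain ⟨s, t, hs, ht0, ht1, rfl⟩ := T.coords hε hx
      exact ⟨(s, t), ⟨⟨hs, ht0, ht1⟩, hx⟩, rfl⟩
    · rintro ⟨p, ⟨-, hp⟩, rfl⟩
      exact hp
  have hsub : strip Ω L ε σ M ⊆ Ico 0 (2 * L) ×ˢ Ioo (-δ) δ := by
    rintro ⟨s, t⟩ ⟨⟨h1, h2, h3⟩, -⟩
    dsimp only at h2 h3
    exact ⟨h1, by dsimp only; linarith [T.hδ], by dsimp only; linarith⟩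
  have hcv : ∫ x in OmegaEps Ω ε, F x = ∫ p in strip Ω L ε σ M, |(dPhi σ M p).det| • F (Phi σ M p) := by
    conv_lhs => rw [him]
    exact integral_image_eq_integral_abs_det_fderiv_smul volume (T.strip_meas ε)
      (fun p _ => (Phi_hasFDerivAt T.sm p).hasFDerivWithinAt) (T.injOn_strip.mono hsub) F
  have hdet : ∀ p ∈ strip Ω L ε σ M, 1 / 2 ≤ |(dPhi σ M p).det| ∧ |(dPhi σ M p).det| ≤ 2 := by
    intro p hp
    have := (hsub hp).2
    have h := (abs_lt.2 this).le
    rw [T.abs_det_bounds T.hσ h]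
    exact T.det_bounds T.hσ h
  have hFP : Continuous (fun p => F (Phi σ M p)) := hF.comp (Phi_contDiff T.sm).continuous
  have hdc : Continuous (fun p => |(dPhi σ M p).det|) := by
    have h1 := dPhis_continuous (σ := σ) T.sm
    have h2 : Continuous (fun p : ℝ × ℝ => nrm σ M p.1) := (nrm_contDiff T.sm).continuous.comp continuous_fst
    simp_rw [dPhi_det]
    exact ((h1.fst.mul h2.snd).sub (h2.fst.mul h1.snd)).abs
  have i1 : IntegrableOn (fun p => F (Phi σ M p)) (strip Ω L ε σ M) :=
    (box_int hFP L ε).mono_set inter_subset_left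
  have i2 : IntegrableOn (fun p => |(dPhi σ M p).det| • F (Phi σ M p)) (strip Ω L ε σ M) :=
    (box_int (hdc.mul hFP) L ε).mono_set inter_subset_left
  rw [hcv, ← integral_const_mul, ← integral_const_mul]
  constructor
  · refine setIntegral_mono_on i2 (i1.const_mul 2) (T.strip_meas ε) (fun p hp => ?_)
    exact mul_le_mul_of_nonneg_right (hdet p hp).2 (hF0 _)
  · refine setIntegral_mono_on i1 (i2.const_mul 2) (T.strip_meas ε) (fun p hp => ?_)
    have := mul_le_mul_of_nonneg_right (hdet p hp).1 (hF0 (Phi σ M p))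
    rw [smul_eq_mul]
    linarith

end STube

namespace STube
variable {Ω : Set (ℝ × ℝ)} {L K c δ σ : ℝ} {M : ℝ → ℝ × ℝ}

theorem lower_int (T : STube Ω L K c δ σ M) {A : ℝ × ℝ → ℝ × ℝ} (hA : Continuous A) {u : ℝ × ℝ → ℂ}
    (hu : ContDiff ℝ 1 u) {b ε : ℝ} (h0 : 0 < ε) (hε : 2 * ε ≤ δ) (hε2 : 9 * K * ε ≤ c ^ 2)
    (hph : ∀ t, 0 < t → t < ε →
      1 ≤ ‖Complex.exp (-(Complex.I * ((b * circ A σ M L t : ℝ) : ℂ))) - 1‖) :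
    (∫ x in OmegaEps Ω ε, ‖u x‖ ^ 2) ≤
      (4 * (128 * L ^ 2 + δ ^ 2)) * ∫ x in OmegaEps Ω ε, mgNormSq b A u x := by
  have hL := T.hL
  have hδ := T.hδ
  set S := strip Ω L ε σ M with hS
  have hSm : MeasurableSet S := T.strip_meas ε
  have hmc := mg_continuous hA hu b
  set q : ℝ × ℝ → ℝ := fun p => mgNormSq b A u (Phi σ M p) with hq
  have hqc : Continuous q := hmc.comp (Phi_contDiff T.sm).continuous
  have hq0 : ∀ p, 0 ≤ q p := fun p => mg_nonneg _ _ _ _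
  set B : Set (ℝ × ℝ) := Ico 0 (2 * L) ×ˢ Ioo 0 (2 * ε) with hB
  have hSB : S ⊆ B := inter_subset_left
  have hBm : MeasurableSet B := measurableSet_Ico.prod measurableSet_Ioo
  have hpr : (volume : Measure (ℝ × ℝ)).restrict B =
      (volume.restrict (Ico 0 (2 * L))).prod (volume.restrict (Ioo 0 (2 * ε))) :=
    (Measure.prod_restrict _ _).symm
  set J : ℝ × ℝ → ℝ := S.indicator q with hJ
  have hJ0 : ∀ p, 0 ≤ J p := fun p => indicator_nonneg (fun p _ => hq0 p) p
  have hJi : Integrable J ((volume.restrict (Ico 0 (2 * L))).prod (volume.restrict (Ioo 0 (2 * ε)))) := by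
    rw [← hpr]
    exact (box_int hqc L ε).indicator hSm
  have hJint : ∫ p in B, J p = ∫ p in S, q p := by
    rw [hJ, setIntegral_indicator hSm, inter_eq_self_of_subset_right hSB]
  set R : ℝ → ℝ := fun s => ∫ r in Ioo 0 (2 * ε), J (s, r) with hR
  have hRint : ∫ s in Ico 0 (2 * L), R s = ∫ p in S, q p := by
    rw [← hJint, hpr, integral_prod _ hJi]
  have hRi : IntegrableOn R (Ico 0 (2 * L)) := hJi.integral_prod_left
  set Q : ℝ → ℝ := fun t => ∫ s in (0 : ℝ)..2 * L, q (s, t) with hQ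
  have hQc : Continuous Q := by
    refine intervalIntegral.continuous_parametric_intervalIntegral_of_continuous' ?_ 0 (2 * L)
    exact hqc.comp (continuous_snd.prodMk continuous_fst)
  -- pointwise bound
  have hpt : ∀ p ∈ S, ‖u (Phi σ M p)‖ ^ 2 ≤ 32 * L * Q (p.2 / 2) + 2 * ε * R p.1 := by
    rintro ⟨s, t⟩ ⟨⟨hs, ht0, ht1⟩, hp⟩
    dsimp only at hs ht0 ht1 ⊢
    have s2 := T.step2 hA hu b s ht0.le
    have s1 := T.step1 hA hu (b := b) (t := t / 2) (by rw [abs_of_pos (by linarith)]; linarith)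
      (hph (t / 2) (by linarith) (by linarith)) s
    have s3 : (∫ r in (t / 2)..t, mgNormSq b A u (Phi σ M (s, r))) ≤ R s := by
      rw [intervalIntegral.integral_of_le (by linarith)]
      have hmem : ∀ r ∈ Ioc (t / 2) t, (s, r) ∈ S := by
        intro r hr
        have hr0 : 0 < r := by linarith [hr.1]
        refine ⟨⟨hs, hr0, by dsimp only; linarith [hr.2]⟩, ?_⟩
        have := T.star hε hε2 ht0 ht1 hp (θ := r / t) (by positivity) ((div_le_one ht0).2 hr.2)
        rwa [div_mul_cancel₀ _ ht0.ne'] at this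
      have e : ∫ r in Ioc (t / 2) t, mgNormSq b A u (Phi σ M (s, r)) = ∫ r in Ioc (t / 2) t, J (s, r) := by
        refine setIntegral_congr_fun measurableSet_Ioc (fun r hr => ?_)
        simp only [hJ, indicator_of_mem (hmem r hr)]
        rfl
      rw [e]
      refine setIntegral_mono_set ?_ (Filter.Eventually.of_forall fun r => hJ0 _) ?_
      · have hm : MeasurableSet ((fun r : ℝ => (s, r)) ⁻¹' S) := measurable_prodMk_left hSm
        have hqs : IntegrableOn (fun r => q (s, r)) (Ioo 0 (2 * ε)) :=
          ((hqc.comp (continuous_const.prodMk continuous_id)).continuousOn.integrableOn_compact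
            isCompact_Icc).mono_set Ioo_subset_Icc_self
        exact hqs.indicator hm
      · refine HasSubset.Subset.eventuallyLE fun r hr => ⟨by linarith [hr.1], by linarith [hr.2]⟩
    have s4 : 0 ≤ R s := integral_nonneg fun r => hJ0 _
    have s5 : t * (∫ r in (t / 2)..t, mgNormSq b A u (Phi σ M (s, r))) ≤ 2 * ε * R s := by
      calc _ ≤ t * R s := mul_le_mul_of_nonneg_left s3 ht0.le
        _ ≤ 2 * ε * R s := mul_le_mul_of_nonneg_right ht1.le s4
    have s6 : ‖u (Phi σ M (s, t / 2))‖ ^ 2 ≤ 16 * L * Q (t / 2) := s1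
    linarith
  have hQ0 : ∀ t, 0 ≤ Q t := fun t => intervalIntegral.integral_nonneg (by linarith) fun s _ => hq0 _
  have hR0 : ∀ s, 0 ≤ R s := fun s => integral_nonneg fun r => hJ0 _
  have i1 : Integrable (fun p : ℝ × ℝ => 32 * L * Q (p.2 / 2))
      ((volume.restrict (Ico 0 (2 * L))).prod (volume.restrict (Ioo 0 (2 * ε)))) := by
    rw [← hpr]
    exact box_int (continuous_const.mul (hQc.comp (continuous_snd.div_const 2))) L ε
  have i2 : Integrable (fun p : ℝ × ℝ => 2 * ε * R p.1)
      ((volume.restrict (Ico 0 (2 * L))).prod (volume.restrict (Ioo 0 (2 * ε)))) :=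
    (hRi.comp_fst _).const_mul (2 * ε)
  have hvi : IntegrableOn (fun p => ‖u (Phi σ M p)‖ ^ 2) B :=
    box_int ((hu.continuous.comp (Phi_contDiff T.sm).continuous).norm.pow 2) L ε
  have hbig : (∫ p in S, ‖u (Phi σ M p)‖ ^ 2) ≤ ∫ p in B, (32 * L * Q (p.2 / 2) + 2 * ε * R p.1) := by
    have i3 : IntegrableOn (fun p : ℝ × ℝ => 32 * L * Q (p.2 / 2) + 2 * ε * R p.1) B := by
      unfold IntegrableOn
      rw [hpr]; exact i1.add i2
    refine (setIntegral_mono_on (hvi.mono_set hSB) (i3.mono_set hSB) hSm hpt).trans ?_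
    refine setIntegral_mono_set i3 (Filter.Eventually.of_forall fun p => ?_) hSB.eventuallyLE
    have := mul_nonneg (by positivity : 0 ≤ 32 * L) (hQ0 (p.2 / 2))
    have := mul_nonneg (by positivity : 0 ≤ 2 * ε) (hR0 p.1)
    simp only [Pi.zero_apply]
    linarith
  have hcalc : ∫ p in B, (32 * L * Q (p.2 / 2) + 2 * ε * R p.1) =
      64 * L ^ 2 * (∫ t in Ioo 0 (2 * ε), Q (t / 2)) + 4 * ε ^ 2 * ∫ p in S, q p := by
    rw [hpr, integral_add i1 i2, integral_prod _ i1, integral_prod_symm _ i2]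
    simp only [integral_const_mul]
    rw [hRint]
    simp only [integral_const, smul_eq_mul]
    have m1 : (volume.restrict (Ico 0 (2 * L))).real univ = 2 * L := by
      simp [measureReal_def, hL.le]
    have m2 : (volume.restrict (Ioo 0 (2 * ε))).real univ = 2 * ε := by
      simp [measureReal_def, h0.le]
    rw [m1, m2]; ring
  have hQhalf : ∫ t in Ioo 0 (2 * ε), Q (t / 2) = 2 * ∫ t in Ioo 0 ε, Q t := by
    rw [← integral_Ioc_eq_integral_Ioo, ← integral_Ioc_eq_integral_Ioo,
      ← intervalIntegral.integral_of_le (by linarith), ← intervalIntegral.integral_of_le h0.le,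
      intervalIntegral.integral_comp_div _ two_ne_zero]
    simp
  have hQle : (∫ t in Ioo 0 ε, Q t) ≤ ∫ p in S, q p := by
    have hsub : Ico 0 (2 * L) ×ˢ Ioo 0 ε ⊆ S := by
      rintro ⟨s, t⟩ ⟨hs, ht0, ht1⟩
      dsimp only at hs ht0 ht1
      exact ⟨⟨hs, ht0, by dsimp only; linarith⟩, T.mem_eps (by linarith) ht0 ht1⟩
    have hqi : IntegrableOn q (Ico 0 (2 * L) ×ˢ Ioo 0 ε) :=
      ((box_int hqc L ε).mono_set hSB).mono_set hsub
    have e : ∫ p in Ico 0 (2 * L) ×ˢ Ioo 0 ε, q p = ∫ t in Ioo 0 ε, Q t := by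
      have hpr' : (volume : Measure (ℝ × ℝ)).restrict (Ico 0 (2 * L) ×ˢ Ioo 0 ε) =
        (volume.restrict (Ico 0 (2 * L))).prod (volume.restrict (Ioo 0 ε)) :=
        (Measure.prod_restrict _ _).symm
      unfold IntegrableOn at hqi
      rw [hpr'] at hqi ⊢
      rw [integral_prod_symm _ hqi]
      refine integral_congr_ae (Filter.Eventually.of_forall fun t => ?_)
      simp only [hQ]
      rw [intervalIntegral.integral_of_le (by linarith), integral_Ico_eq_integral_Ioo,
        integral_Ioc_eq_integral_Ioo]
    rw [← e]
    exact setIntegral_mono_set ((box_int hqc L ε).mono_set hSB) (Filter.Eventually.of_forall hq0)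
      hsub.eventuallyLE
  have c1 := (T.strip_cov hε (F := fun x => ‖u x‖ ^ 2) (hu.continuous.norm.pow 2) (fun x => by positivity)).1
  have c2 := (T.strip_cov hε hmc (fun x => mg_nonneg b A u x)).2
  rw [← hS] at c1 c2
  have c3 : 0 ≤ ∫ p in S, q p := integral_nonneg hq0
  have c4 : (∫ p in S, q p) ≤ 2 * ∫ x in OmegaEps Ω ε, mgNormSq b A u x := c2
  rw [hcalc, hQhalf] at hbig
  have c5 : 64 * L ^ 2 * (2 * ∫ t in Ioo 0 ε, Q t) ≤ 128 * L ^ 2 * ∫ p in S, q p := by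
    have := mul_le_mul_of_nonneg_left hQle (by positivity : 0 ≤ 128 * L ^ 2)
    linarith
  have c6 : 4 * ε ^ 2 * (∫ p in S, q p) ≤ δ ^ 2 * ∫ p in S, q p := by
    refine mul_le_mul_of_nonneg_right ?_ c3
    nlinarith
  have c7 : (128 * L ^ 2 + δ ^ 2) * (∫ p in S, q p) ≤
      (128 * L ^ 2 + δ ^ 2) * (2 * ∫ x in OmegaEps Ω ε, mgNormSq b A u x) :=
    mul_le_mul_of_nonneg_left c4 (by positivity)
  linarith

theorem lower (T : STube Ω L K c δ σ M) {A : ℝ × ℝ → ℝ × ℝ} (hA : Continuous A) {b : ℝ}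
    (hb : b * circ A σ M L 0 = π ∨ b * circ A σ M L 0 = -π) :
    ∃ ε₀ > 0, ∀ ε, 0 < ε → ε < ε₀ → 1 / (4 * (128 * L ^ 2 + δ ^ 2)) ≤ lam Ω A ε b := by
  have hL := T.hL
  have hδ := T.hδ
  have hK := T.hK
  have hc := T.hc
  have hcc := circ_continuous (σ := σ) (L := L) T.sm hA
  set ph : ℝ → ℝ := fun t => ‖Complex.exp (-(Complex.I * ((b * circ A σ M L t : ℝ) : ℂ))) - 1‖ with hph
  have hphc : Continuous ph := by
    have h1 : Continuous (fun t => ((b * circ A σ M L t : ℝ) : ℂ)) :=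
      Complex.continuous_ofReal.comp (continuous_const.mul hcc)
    have h2 : Continuous (fun t => Complex.exp (-(Complex.I * ((b * circ A σ M L t : ℝ) : ℂ)))) :=
      Complex.continuous_exp.comp (continuous_const.mul h1).neg
    exact (h2.sub continuous_const).norm
  have hph0 : ph 0 = 2 := by
    simp only [hph]
    have : Complex.exp (-(Complex.I * ((b * circ A σ M L 0 : ℝ) : ℂ))) = -1 := by
      rcases hb with h | h <;> rw [h]
      · rw [show -(Complex.I * ((π : ℝ) : ℂ)) = -((π : ℂ) * Complex.I) by ring, Complex.exp_neg,
          Complex.exp_pi_mul_I]; norm_num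
      · rw [show -(Complex.I * ((-π : ℝ) : ℂ)) = (π : ℂ) * Complex.I by push_cast; ring,
          Complex.exp_pi_mul_I]
    rw [this]; norm_num
  obtain ⟨ρ, hρ, hρs⟩ := Metric.continuous_iff.1 hphc 0 1 one_pos
  refine ⟨min ρ (min (δ / 2) (c ^ 2 / (9 * K))), by positivity, fun ε h0 h1 => ?_⟩
  have e1 : ε < ρ := lt_of_lt_of_le h1 (min_le_left _ _)
  have e2 : ε < δ / 2 := lt_of_lt_of_le h1 ((min_le_right _ _).trans (min_le_left _ _))
  have e3 : ε < c ^ 2 / (9 * K) := lt_of_lt_of_le h1 ((min_le_right _ _).trans (min_le_right _ _))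
  rw [lt_div_iff₀ (by positivity)] at e3
  have hphase : ∀ t, 0 < t → t < ε → 1 ≤ ph t := by
    intro t ht0 ht1
    have := hρs t (by rw [dist_zero_right, Real.norm_eq_abs, abs_of_pos ht0]; linarith)
    rw [hph0, Real.dist_eq, abs_lt] at this
    linarith [this.1]
  unfold lam
  refine le_csInf ?_ ?_
  · have hvp := T.vol_pos h0 (by linarith)
    refine ⟨_, fun _ => 1, ⟨univ, isOpen_univ, subset_univ _, contDiffOn_const⟩, ?_, rfl⟩
    simpa using hvp
  · rintro _ ⟨u, hu, hpos, rfl⟩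
    obtain ⟨g, hg, hgu⟩ := exists_ext hu
    have hmeas : MeasurableSet (OmegaEps Ω ε) := (T.isOpen_eps ε).measurableSet
    have g1 : ∫ x in OmegaEps Ω ε, ‖u x‖ ^ 2 = ∫ x in OmegaEps Ω ε, ‖g x‖ ^ 2 :=
      setIntegral_congr_fun hmeas fun x hx => by
        simp only [(hgu x (subset_closure hx)).eq_of_nhds]
    have g2 : ∫ x in OmegaEps Ω ε, mgNormSq b A u x = ∫ x in OmegaEps Ω ε, mgNormSq b A g x :=
      setIntegral_congr_fun hmeas fun x hx => by
        simp only [mgNormSq, (hgu x (subset_closure hx)).eq_of_nhds, (hgu x (subset_closure hx)).fderiv_eq]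
    have := T.lower_int hA hg (b := b) h0 (by linarith) (by linarith) hphase
    rw [← g1, ← g2] at this
    rw [div_le_div_iff₀ (by positivity) hpos]
    linarith

end STube

theorem lam_congr {Ω : Set (ℝ × ℝ)} (ho : IsOpen Ω) {A A' : ℝ × ℝ → ℝ × ℝ} (h : ∀ x ∈ Ω, A' x = A x)
    (ε b : ℝ) : lam Ω A' ε b = lam Ω A ε b := by
  have hm : MeasurableSet (OmegaEps Ω ε) :=
    (ho.inter (isOpen_lt (Metric.continuous_infDist_pt _) continuous_const)).measurableSet
  have : ∀ u : ℝ × ℝ → ℂ, ∫ x in OmegaEps Ω ε, mgNormSq b A' u x = ∫ x in OmegaEps Ω ε, mgNormSq b A u x :=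
    fun u => setIntegral_congr_fun hm fun x hx => by simp only [mgNormSq, h x hx.1]
  unfold lam
  simp only [this]

/-- Lack of strong diamagnetism: there is a sequence of thicknesses tending to
zero along which `H ↦ λ(ε_N, H)` fails to be monotone increasing on `[0, ∞)`. -/
theorem stmt_8 (Ω : Set (ℝ × ℝ)) (hΩo : IsOpen Ω) (hΩb : Bornology.IsBounded Ω)
    (hΩsc : SimplyConnectedSpace ↥Ω)
    (L : ℝ) (hL : 0 < L) (M : ℝ → ℝ × ℝ) (hM : BoundaryParam Ω L M)
    (A : ℝ × ℝ → ℝ × ℝ) (hA : C1Nhd A Ω) (hcurl : ∀ x ∈ Ω, curl2 A x = 1) :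
    ∃ ε : ℕ → ℝ, (∀ N, 0 < ε N) ∧
      Filter.Tendsto ε Filter.atTop (nhds 0) ∧
      ∀ N, ¬ MonotoneOn (fun H => lam Ω A (ε N) H) (Set.Ici (0 : ℝ)) := by
  have hne : Ω.Nonempty := by
    have : Nonempty ↥Ω := inferInstance
    exact nonempty_coe_sort.1 this
  obtain ⟨K, c, δ, T0⟩ := exists_tube hL hM
  obtain ⟨σ, T⟩ := exists_stube T0 hΩo hΩb hne hM.2.2.2.2
  obtain ⟨A', hA', hAA⟩ := exists_ext hA
  have hAe : ∀ x ∈ Ω, A' x = A x := fun x hx => (hAA x (subset_closure hx)).eq_of_nhds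
  have hcurl' : ∀ x ∈ Ω, curl2 A' x = 1 := by
    intro x hx
    have h := hAA x (subset_closure hx)
    have h1 : (fun y => (A' y).1) =ᶠ[nhds x] fun y => (A y).1 := h.fun_comp Prod.fst
    have h2 : (fun y => (A' y).2) =ᶠ[nhds x] fun y => (A y).2 := h.fun_comp Prod.snd
    rw [← hcurl x hx, curl2, curl2, h1.fderiv_eq, h2.fderiv_eq]
  set F := circ A' σ M L 0 with hF
  have hF0 : F ≠ 0 := T.circ_ne_zero hA' hcurl'
  have hFa : 0 < |F| := abs_pos.2 hF0
  have hpi := Real.pi_pos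
  have hδ := T.hδ
  obtain ⟨ε₁, h1, low⟩ := T.lower hA'.continuous (b := π / |F|) (by
    rcases abs_choice F with h | h
    · left; rw [h, ← hF]; field_simp
    · right; rw [h, ← hF]; field_simp)
  obtain ⟨ε₂, h2, up⟩ := T.upper hA' (b := 2 * π / |F|) (η := 1 / (4 * (128 * L ^ 2 + δ ^ 2)) / 2) (by
    rcases abs_choice F with h | h
    · refine ⟨1, ?_⟩; rw [h, ← hF]; push_cast; field_simp
    · refine ⟨-1, ?_⟩; rw [h, ← hF]; push_cast; field_simp) (by positivity)
  set e := min ε₁ ε₂ with he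
  have hep : 0 < e := lt_min h1 h2
  have hlt : ∀ N : ℕ, e / ((N : ℝ) + 2) < e := fun N => by
    apply div_lt_self hep
    have : (0 : ℝ) ≤ N := Nat.cast_nonneg N
    linarith
  refine ⟨fun N => e / ((N : ℝ) + 2), fun N => by positivity, ?_, fun N hmono => ?_⟩
  · exact Filter.Tendsto.div_atTop tendsto_const_nhds
      (Filter.tendsto_atTop_add_const_right _ _ tendsto_natCast_atTop_atTop)
  · have hN : 0 < e / ((N : ℝ) + 2) := by positivity
    have a1 := low _ hN ((hlt N).trans_le (min_le_left _ _))
    have a2 := up _ hN ((hlt N).trans_le (min_le_right _ _))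
    have a3 := hmono (a := π / |F|) (b := 2 * π / |F|) (by simp only [mem_Ici]; positivity)
      (by simp only [mem_Ici]; positivity) (by gcongr; linarith)
    dsimp only at a3
    rw [lam_congr hΩo hAe] at a1 a2
    have : 0 < 1 / (4 * (128 * L ^ 2 + δ ^ 2)) := by positivity
    linarith
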